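/- arXiv:math/0401054 — 11 statements merged into one kernel-verified Lean document; each statement's English description precedes it below -/
import Mathlib

section
/- Let N = m₁ + ⋯ + m_J and let A = blockdiag{a₁ I_{m₁}, …, a_J I_{m_J}} be the real diagonal N×N matrix whose pairwise distinct real entries a₁, …, a_J appear with multiplicities m₁, …, m_J. Then for every complex N×N matrix B there exists an N×N matrix K with K* = −K (skew-Hermitian) such that the Hermitian part of B − KA equals the Hermitian part of blockdiag B, where blockdiag B denotes the block-diagonal part of B with respect to the partition (m₁, …, m_J). Moreover, if B is real then K may be chosen real skew-symmetric. -/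
open Matrix

/-- Hyperbolic compensation construction (Lemma of [Hu, MaZ.5]): for a real
diagonal matrix `A = blockdiag {aⱼ I_{mⱼ}}` with distinct entries `aⱼ` and any
complex matrix `B`, there is a skew-Hermitian `K` with
`Re (B - K A) = Re (blockdiag B)`; if `B` is real, `K` can be chosen real. -/
theorem stmt_1 (J : ℕ) (m : Fin J → ℕ) (a : Fin J → ℝ) (ha : Function.Injective a)
    (A B : Matrix ((j : Fin J) × Fin (m j)) ((j : Fin J) × Fin (m j)) ℂ)
    (hA : ∀ p q, A p q = if p = q then (a p.1 : ℂ) else 0) :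
    ∃ K : Matrix ((j : Fin J) × Fin (m j)) ((j : Fin J) × Fin (m j)) ℂ,
      Kᴴ = -K ∧
      (1 / 2 : ℂ) • ((B - K * A) + (B - K * A)ᴴ) =
        (1 / 2 : ℂ) • ((Matrix.of fun p q => if p.1 = q.1 then B p q else 0) +
          (Matrix.of fun p q => if p.1 = q.1 then B p q else 0)ᴴ) ∧
      ((∀ p q, (B p q).im = 0) → ∀ p q, (K p q).im = 0) := by
  have hAdiag : A = Matrix.diagonal fun p => (a p.1 : ℂ) := by
    ext p q
    rw [hA, Matrix.diagonal_apply]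
  subst hAdiag
  refine ⟨Matrix.of fun p q => (B p q + star (B q p)) / ((a q.1 - a p.1 : ℝ) : ℂ), ?_, ?_, ?_⟩
  · ext p q
    simp only [conjTranspose_apply, of_apply, Matrix.neg_apply, star_div₀, star_add,
      Complex.star_def, Complex.conj_conj, Complex.conj_ofReal]
    rw [← neg_sub (a q.1), Complex.ofReal_neg, div_neg, add_comm]
  · congr 1
    ext p q
    simp only [Matrix.add_apply, Matrix.sub_apply, conjTranspose_apply, mul_diagonal, of_apply, star_sub,
      star_mul', star_div₀, star_add, Complex.star_def, Complex.conj_conj, Complex.conj_ofReal]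
    by_cases h : p.1 = q.1
    · simp [h]
    · have hne : (a q.1 : ℂ) - a p.1 ≠ 0 :=
        sub_ne_zero.mpr fun e => h (ha (Complex.ofReal_injective e)).symm
      simp only [h, Ne.symm h, if_false, map_zero, add_zero]
      push_cast
      rw [← neg_sub (a q.1 : ℂ) (a p.1), div_neg]
      field_simp
      ring
  · intro hB p q
    rw [of_apply, Complex.div_ofReal_im]
    simp [hB]
end

section
/- Let A⁰, A, B be real n×n matrices such that A⁰ is symmetric positive definite, A⁰A is symmetric, and A⁰B is symmetric positive semidefinite. Then the following are equivalent: (K0) no eigenvector of A lies in ker B, i.e., there is no nonzero v ∈ ℂⁿ with Av = μv for some μ ∈ ℂ and Bv = 0; (K3) there exists θ > 0 such that for every ξ ∈ ℝ, every eigenvalue λ ∈ ℂ of the complex matrix −iξA − ξ²B satisfies Re λ ≤ −θ ξ²/(1+ξ²). -/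
open Matrix

section InnerProductSpace

open scoped InnerProductSpace

variable {E : Type*} [NormedAddCommGroup E] [InnerProductSpace ℂ E] [FiniteDimensional ℂ E]

/-- If no eigenvector of `A` lies in the kernel of `B`, then `‖A v - μ v‖² + ‖B v‖²` is bounded
below by a multiple of `‖v‖²`, uniformly in `μ`. -/
theorem exists_pos_mul_sq_norm_le_of_no_eigenvector_mem_ker (A B : E →L[ℂ] E)
    (h : ∀ v : E, v ≠ 0 → ∀ μ : ℂ, A v = μ • v → B v ≠ 0) :
    ∃ c > 0, ∀ (v : E) (μ : ℂ), c * ‖v‖ ^ 2 ≤ ‖A v - μ • v‖ ^ 2 + ‖B v‖ ^ 2 := by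
  let g : E → ℝ := fun v ↦ ‖A v - ⟪v, A v⟫_ℂ • v‖ ^ 2 + ‖B v‖ ^ 2
  have hg : Continuous g := by fun_prop
  have hg0 : ∀ v ∈ Metric.sphere (0 : E) 1, 0 < g v := by
    intro v hv
    have hv0 : v ≠ 0 := ne_zero_of_mem_unit_sphere ⟨v, hv⟩
    by_cases hA : A v = ⟪v, A v⟫_ℂ • v
    · have := norm_pos_iff.2 (h v hv0 _ hA)
      positivity
    · have := norm_pos_iff.2 (sub_ne_zero.2 hA)
      positivity
  have : ProperSpace E := FiniteDimensional.proper ℂ E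
  obtain ⟨c, hc, hcg⟩ := (isCompact_sphere (0 : E) 1).exists_forall_le' hg.continuousOn hg0
  have unit : ∀ (v : E) (μ : ℂ), ‖v‖ = 1 → c / 4 ≤ ‖A v - μ • v‖ ^ 2 + ‖B v‖ ^ 2 := by
    intro v μ hv
    have h1 : A v - ⟪v, A v⟫_ℂ • v = (A v - μ • v) - ⟪v, A v - μ • v⟫_ℂ • v := by
      rw [inner_sub_right, inner_smul_right, inner_self_eq_norm_sq_to_K, hv]
      module
    have h2 : ‖A v - ⟪v, A v⟫_ℂ • v‖ ≤ 2 * ‖A v - μ • v‖ := by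
      rw [h1]
      refine (norm_sub_le _ _).trans ?_
      have := norm_inner_le_norm (𝕜 := ℂ) v (A v - μ • v)
      rw [norm_smul, hv]
      rw [hv] at this
      linarith
    have h3 : c ≤ ‖A v - ⟪v, A v⟫_ℂ • v‖ ^ 2 + ‖B v‖ ^ 2 := hcg v (by simpa using hv)
    have h4 := pow_le_pow_left₀ (norm_nonneg _) h2 2
    nlinarith [sq_nonneg ‖B v‖]
  refine ⟨c / 4, by positivity, fun v μ ↦ ?_⟩
  rcases eq_or_ne v 0 with rfl | hv
  · simp
  have hv' : 0 < ‖v‖ := norm_pos_iff.2 hv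
  have hu := unit ((‖v‖⁻¹ : ℂ) • v) μ (by simp [norm_smul, hv'.ne'])
  rw [map_smul, map_smul, smul_comm μ, ← smul_sub, norm_smul, norm_smul, norm_inv,
    Complex.norm_real, norm_norm, mul_pow, mul_pow, ← mul_add, inv_pow] at hu
  rwa [le_inv_mul_iff₀ (by positivity), mul_comm] at hu

/-- Strict dissipativity of `-iξA - ξ²B` for a genuinely coupled pair `(A, B)` with
symmetrizer `Q†Q`, where `Q†Q B = R†R`. -/
theorem exists_pos_forall_eigenvalue_re_le (A B Q R T : E →L[ℂ] E)
    (hT : T * (star Q * Q) = 1) (hA : IsSelfAdjoint (star Q * Q * A))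
    (hB : star Q * Q * B = star R * R)
    (h : ∀ v : E, v ≠ 0 → ∀ μ : ℂ, A v = μ • v → B v ≠ 0) :
    ∃ θ > 0, ∀ (ξ : ℝ) (l : ℂ) (v : E), v ≠ 0 →
      (-(Complex.I * (ξ : ℂ))) • A v - ((ξ : ℂ) ^ 2) • B v = l • v →
      l.re ≤ -θ * ξ ^ 2 / (1 + ξ ^ 2) := by
  obtain ⟨c, hc, hcv⟩ := exists_pos_mul_sq_norm_le_of_no_eigenvector_mem_ker A B h
  have inner_star_mul (S : E →L[ℂ] E) (v : E) : ⟪v, (star S * S) v⟫_ℂ = (‖S v‖ ^ 2 : ℝ) := by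
    rw [ContinuousLinearMap.star_eq_adjoint, mul_apply_eq_comp,
      ContinuousLinearMap.adjoint_inner_right, inner_self_eq_norm_sq_to_K]
    simp
  let K : ℝ := ‖T * star R‖ ^ 2 + 1
  let L : ℝ := ‖Q‖ ^ 2 + 1
  have hK : 0 < K := by positivity
  have hL : 0 < L := by positivity
  have hBR (v : E) : ‖B v‖ ^ 2 ≤ K * ‖R v‖ ^ 2 := by
    have h1 : B = T * star R * R := by
      rw [mul_assoc, ← hB, ← mul_assoc, hT, one_mul]
    have h2 : ‖B v‖ ≤ ‖T * star R‖ * ‖R v‖ := by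
      conv_lhs => rw [h1]
      exact (T * star R).le_opNorm (R v)
    have h3 := pow_le_pow_left₀ (norm_nonneg _) h2 2
    rw [mul_pow] at h3
    nlinarith [sq_nonneg ‖R v‖]
  have hQL (v : E) : ‖Q v‖ ^ 2 ≤ L * ‖v‖ ^ 2 := by
    have h3 := pow_le_pow_left₀ (norm_nonneg _) (Q.le_opNorm v) 2
    rw [mul_pow] at h3
    nlinarith [sq_nonneg ‖v‖]
  refine ⟨c / (K * L), by positivity, fun ξ l v hv hl ↦ ?_⟩
  have hQv : 0 < ‖Q v‖ := by
    refine norm_pos_iff.2 fun h0 ↦ hv ?_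
    have := congrArg (fun S : E →L[ℂ] E ↦ S v) hT
    simpa [h0] using this.symm
  have energy : l.re * ‖Q v‖ ^ 2 = -(ξ ^ 2 * ‖R v‖ ^ 2) := by
    have h1 := congrArg (fun w ↦ ⟪v, (star Q * Q) w⟫_ℂ) hl
    simp only [map_sub, map_smul, inner_sub_right, inner_smul_right, inner_star_mul] at h1
    rw [← mul_apply_eq_comp _ A, ← mul_apply_eq_comp _ B, hB,
      inner_star_mul] at h1
    have him : (⟪v, (star Q * Q * A) v⟫_ℂ).im = 0 :=
      (ContinuousLinearMap.isSelfAdjoint_iff_isSymmetric.1 hA).im_inner_self_apply v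
    have h2 := congrArg Complex.re h1
    rw [← Complex.ofReal_pow ξ, ← Complex.ofReal_mul, Complex.sub_re, Complex.ofReal_re,
      Complex.re_mul_ofReal] at h2
    generalize ⟪v, (star Q * Q * A) v⟫_ℂ = s at him h2
    simp [him] at h2
    linarith
  have coupling : c * ‖v‖ ^ 2 * ξ ^ 2 ≤ (1 + ξ ^ 2) * ‖B v‖ ^ 2 * ξ ^ 2 := by
    rcases eq_or_ne ξ 0 with rfl | hξ
    · simp
    have hξ' : (ξ : ℂ) ≠ 0 := by exact_mod_cast hξ
    have h1 := hcv v (Complex.I * l / ξ)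
    have h2 : A v - (Complex.I * l / ξ) • v = (Complex.I * ξ) • B v := by
      rw [mul_div_right_comm, mul_smul, ← hl, smul_sub, smul_smul, smul_smul]
      have e1 : Complex.I / ξ * -(Complex.I * ξ) = 1 := by
        field_simp
        simp
      have e2 : Complex.I / ξ * (ξ : ℂ) ^ 2 = Complex.I * ξ := by field_simp
      rw [e1, e2]
      module
    rw [h2, norm_smul, mul_pow] at h1
    simp only [norm_mul, Complex.norm_I, Complex.norm_real, one_mul, Real.norm_eq_abs,
      sq_abs] at h1
    refine mul_le_mul_of_nonneg_right ?_ (sq_nonneg ξ)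
    linarith
  rw [show -(c / (K * L)) * ξ ^ 2 / (1 + ξ ^ 2) = -(c * ξ ^ 2) / (K * L * (1 + ξ ^ 2)) by
    field_simp, le_div_iff₀ (by positivity)]
  refine le_of_mul_le_mul_right ?_ (pow_pos hQv 2)
  calc l.re * (K * L * (1 + ξ ^ 2)) * ‖Q v‖ ^ 2
      = -(L * ((1 + ξ ^ 2) * (K * ‖R v‖ ^ 2) * ξ ^ 2)) := by
        linear_combination (K * L * (1 + ξ ^ 2)) * energy
    _ ≤ -(L * ((1 + ξ ^ 2) * ‖B v‖ ^ 2 * ξ ^ 2)) := by gcongr; exact hBR v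
    _ ≤ -(L * (c * ‖v‖ ^ 2 * ξ ^ 2)) := by gcongr
    _ = -(c * ξ ^ 2 * (L * ‖v‖ ^ 2)) := by ring
    _ ≤ -(c * ξ ^ 2 * ‖Q v‖ ^ 2) := by gcongr; exact hQL v
    _ = -(c * ξ ^ 2) * ‖Q v‖ ^ 2 := by ring

end InnerProductSpace

/-- A complex number is in the spectrum of a matrix iff it has an eigenvector. -/
theorem Matrix.mem_spectrum_iff_exists_mulVec_eq_smul {m : Type*} [Fintype m] [DecidableEq m]
    {M : Matrix m m ℂ} {l : ℂ} : l ∈ spectrum ℂ M ↔ ∃ v ≠ 0, M *ᵥ v = l • v := by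
  rw [← Matrix.spectrum_toLin', ← Module.End.hasEigenvalue_iff_mem_spectrum]
  constructor
  · intro h
    obtain ⟨v, hv⟩ := h.exists_hasEigenvector
    exact ⟨v, hv.2, by simpa using hv.apply_eq_smul⟩
  · rintro ⟨v, hv, h⟩
    exact Module.End.hasEigenvalue_of_hasEigenvector
      (Module.End.hasEigenvector_iff.2 ⟨Module.End.mem_eigenspace_iff.2 (by simpa using h), hv⟩)

open scoped MatrixOrder in
/-- A positive semidefinite real matrix has the form `Rᴴ R`. -/
theorem Matrix.PosSemidef.exists_eq_conjTranspose_mul_self {m : Type*} [Fintype m] [DecidableEq m]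
    {P : Matrix m m ℝ} (hP : P.PosSemidef) : ∃ R : Matrix m m ℝ, P = Rᴴ * R :=
  CStarAlgebra.nonneg_iff_eq_star_mul_self.mp hP.nonneg

/-- Equivalence of genuine coupling (K0) and strict dissipativity (K3) for a
symmetrizable hyperbolic–parabolic pair `(A, B)` with symmetrizer `A⁰`. -/
theorem stmt_2 (n : ℕ) (A0 A B : Matrix (Fin n) (Fin n) ℝ)
    (hA0 : A0.PosDef) (hA0A : (A0 * A).IsSymm) (hA0B : (A0 * B).PosSemidef) :
    (¬ ∃ v : Fin n → ℂ, v ≠ 0 ∧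
        (∃ μ : ℂ, (A.map Complex.ofReal).mulVec v = μ • v) ∧
        (B.map Complex.ofReal).mulVec v = 0) ↔
    (∃ θ > 0, ∀ ξ : ℝ, ∀ l ∈ spectrum ℂ
        ((-(Complex.I * (ξ : ℂ))) • A.map Complex.ofReal -
          ((ξ : ℂ) ^ 2) • B.map Complex.ofReal),
      l.re ≤ -θ * ξ ^ 2 / (1 + ξ ^ 2)) := by
  simp only [Matrix.mem_spectrum_iff_exists_mulVec_eq_smul, Matrix.sub_mulVec, Matrix.smul_mulVec]
  constructor
  · intro h
    obtain ⟨Q, hQ⟩ := hA0.posSemidef.exists_eq_conjTranspose_mul_self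
    obtain ⟨R, hR⟩ := hA0B.exists_eq_conjTranspose_mul_self
    let φ := Matrix.toEuclideanCLM (n := Fin n) (𝕜 := ℂ)
    let κ : Matrix (Fin n) (Fin n) ℝ →+* Matrix (Fin n) (Fin n) ℂ := Complex.ofRealHom.mapMatrix
    have hκ (M : Matrix (Fin n) (Fin n) ℝ) : κ Mᴴ = star (κ M) :=
      (Matrix.conjTranspose_map _ fun x ↦ by simp)
    have hφκ : star (φ (κ Q)) * φ (κ Q) = φ (κ A0) := by
      rw [← map_star, ← hκ, ← map_mul, ← map_mul, ← hQ]
    have hφ (M : Matrix (Fin n) (Fin n) ℂ) (v : EuclideanSpace ℂ (Fin n)) (μ : ℂ) :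
        φ M v = μ • v ↔ M *ᵥ v.ofLp = μ • v.ofLp := by
      rw [← (WithLp.ofLp_injective 2).eq_iff]
      simp [φ]
    have hT : φ (κ A0⁻¹) * (star (φ (κ Q)) * φ (κ Q)) = 1 := by
      rw [hφκ, ← map_mul, ← map_mul,
        Matrix.nonsing_inv_mul _ ((Matrix.isUnit_iff_isUnit_det _).1 hA0.isUnit), map_one, map_one]
    have hA : IsSelfAdjoint (star (φ (κ Q)) * φ (κ Q) * φ (κ A)) := by
      rw [hφκ, IsSelfAdjoint, ← map_mul, ← map_mul, ← map_star, ← hκ,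
        Matrix.conjTranspose_eq_transpose_of_trivial, hA0A]
    have hB : star (φ (κ Q)) * φ (κ Q) * φ (κ B) = star (φ (κ R)) * φ (κ R) := by
      rw [hφκ, ← map_star, ← hκ, ← map_mul, ← map_mul, ← map_mul, ← map_mul, hR]
    obtain ⟨θ, hθ, H⟩ := exists_pos_forall_eigenvalue_re_le _ _ _ _ _ hT hA hB
      fun v hv μ hAv hBv ↦ h ⟨v.ofLp, by simpa using hv, ⟨μ, (hφ _ v μ).1 hAv⟩,
        ((hφ (κ B) v 0).1 (by simpa using hBv)).trans (zero_smul ℂ _)⟩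
    refine ⟨θ, hθ, fun ξ l ⟨v, hv, hl⟩ ↦ H ξ l (WithLp.toLp 2 v) (by simpa using hv) ?_⟩
    have := (hφ ((-(Complex.I * (ξ : ℂ))) • κ A - ((ξ : ℂ) ^ 2) • κ B) (WithLp.toLp 2 v) l).2
      (by rwa [Matrix.sub_mulVec, Matrix.smul_mulVec, Matrix.smul_mulVec])
    rwa [map_sub, map_smul, map_smul] at this
  · rintro ⟨θ, hθ, H⟩ ⟨v, hv, ⟨μ, hA⟩, hB⟩
    have h1 := H 1 (-(Complex.I * μ)) ⟨v, hv, by simp [hA, hB, smul_smul]⟩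
    have h2 := H (-1) (Complex.I * μ) ⟨v, hv, by simp [hA, hB, smul_smul]⟩
    norm_num at h1 h2
    linarith
end

section
/- Let A⁰, A, B be real n×n matrices such that A⁰ is symmetric positive definite, A⁰A is symmetric, and A⁰B is symmetric positive semidefinite. Then the following are equivalent: (K0) no eigenvector of A lies in ker B, i.e., there is no nonzero v ∈ ℂⁿ with Av = μv for some μ ∈ ℂ and Bv = 0; (K2) there exists a real skew-symmetric n×n matrix K (Kᵀ = −K) such that the symmetric part of A⁰B − KA is positive definite. -/
open Matrix

section Compensation

variable {n : Type*} [Fintype n]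

/-- A compensating matrix excludes real eigenvectors of `A` in the kernel of `D`. -/
theorem Matrix.mulVec_ne_zero_of_compensating {A D K : Matrix n n ℝ} (hK : Kᵀ = -K)
    (hpos : (((1 : ℝ) / 2) • ((D - K * A) + (D - K * A)ᵀ)).PosDef)
    {x : n → ℝ} {r : ℝ} (hx : x ≠ 0) (hA : A *ᵥ x = r • x) : D *ᵥ x ≠ 0 := by
  intro hDx
  have htr (M : Matrix n n ℝ) : x ⬝ᵥ (Mᵀ *ᵥ x) = x ⬝ᵥ (M *ᵥ x) := by
    rw [mulVec_transpose, dotProduct_comm, dotProduct_mulVec]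
  have hKx : x ⬝ᵥ (K *ᵥ x) = 0 := by
    have := htr K
    rw [hK, neg_mulVec, dotProduct_neg] at this
    linarith
  have h := hpos.dotProduct_mulVec_pos hx
  rw [star_trivial, smul_mulVec, add_mulVec, dotProduct_smul, dotProduct_add, htr, sub_mulVec,
    hDx, ← mulVec_mulVec, hA, mulVec_smul, zero_sub, dotProduct_neg, dotProduct_smul, hKx] at h
  simp at h

/-- The block-diagonal part of a positive semidefinite matrix, with blocks the fibres of `l`,
is positive definite if no nonzero vector supported in a single fibre is in the kernel. -/
theorem Matrix.PosSemidef.posDef_fiberwise {D : Matrix n n ℝ} (hD : D.PosSemidef) (l : n → ℝ)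
    (h : ∀ (μ : ℝ) (x : n → ℝ), x ≠ 0 → (∀ i, l i ≠ μ → x i = 0) → D *ᵥ x ≠ 0) :
    (Matrix.of fun i j => if l i = l j then D i j else 0).PosDef := by
  refine .of_dotProduct_mulVec_pos ?_ fun x hx => ?_
  · ext i j
    have := hD.isHermitian.apply i j
    simp_all [eq_comm (a := l j)]
  · set y : ℝ → n → ℝ := fun μ i => if l i = μ then x i else 0
    have hsum : star x ⬝ᵥ ((Matrix.of fun i j => if l i = l j then D i j else 0) *ᵥ x) =
        ∑ μ ∈ Finset.univ.image l, star (y μ) ⬝ᵥ (D *ᵥ y μ) := by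
      simp only [dotProduct, mulVec, Finset.mul_sum, star_trivial, of_apply, y]
      conv_rhs => rw [Finset.sum_comm]
      refine Finset.sum_congr rfl fun i _ => ?_
      conv_rhs => rw [Finset.sum_comm]
      refine Finset.sum_congr rfl fun j _ => ?_
      rw [Finset.sum_eq_single (l i)]
      · by_cases hij : l i = l j <;> simp [hij, eq_comm (a := l j)]
      · intro μ _ hμ
        simp [hμ.symm]
      · simp
    obtain ⟨i, hi⟩ := Function.ne_iff.mp hx
    rw [hsum]
    refine Finset.sum_pos' (fun μ _ => hD.dotProduct_mulVec_nonneg _)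
      ⟨l i, Finset.mem_image_of_mem _ (Finset.mem_univ i), ?_⟩
    refine (hD.dotProduct_mulVec_nonneg _).lt_of_ne' fun h0 => ?_
    refine h (l i) (y (l i)) (fun hy => hi ?_) (fun j hj => by simp [y, hj])
      ((hD.dotProduct_mulVec_zero_iff _).mp h0)
    simpa [y] using congrFun hy i

variable [DecidableEq n]

open scoped MatrixOrder Matrix.Norms.L2Operator in
/-- A real matrix with a positive definite symmetrizer is diagonalizable over `ℝ`. -/
theorem Matrix.PosDef.exists_isUnit_mul_diagonal {S A : Matrix n n ℝ}
    (hS : S.PosDef) (hSA : (S * A).IsSymm) :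
    ∃ (P : Matrix n n ℝ) (l : n → ℝ), IsUnit P ∧ A * P = P * diagonal l := by
  obtain ⟨C, hC⟩ := CStarAlgebra.nonneg_iff_eq_star_mul_self.mp hS.posSemidef.nonneg
  have hCu : IsUnit C := by
    have h := (isUnit_iff_isUnit_det _).mp hS.isUnit
    rw [hC, det_mul] at h
    exact (isUnit_iff_isUnit_det _).mpr (isUnit_of_mul_isUnit_right h)
  have hdet := (isUnit_iff_isUnit_det _).mp hCu
  have hCt : IsUnit Cᵀ.det := by rwa [det_transpose]
  rw [star_eq_conjTranspose, conjTranspose_eq_transpose_of_trivial] at hC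
  have hG : (C * A * C⁻¹).IsHermitian := by
    have h : C * A * C⁻¹ = (C⁻¹)ᵀ * (S * A) * C⁻¹ := by
      rw [hC, transpose_nonsing_inv, Matrix.mul_assoc Cᵀ, nonsing_inv_mul_cancel_left _ _ hCt]
    rw [h, IsHermitian, conjTranspose_eq_transpose_of_trivial, transpose_mul, transpose_mul,
      hSA.eq, transpose_transpose, ← Matrix.mul_assoc]
  set U : Matrix n n ℝ := (hG.eigenvectorUnitary : Matrix n n ℝ)
  have hU : star U * U = 1 := Unitary.coe_star_mul_self hG.eigenvectorUnitary
  have hGU : C * A * C⁻¹ * U = U * diagonal hG.eigenvalues := by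
    have h := hG.spectral_theorem
    rw [Unitary.conjStarAlgAut_apply] at h
    calc C * A * C⁻¹ * U = U * diagonal hG.eigenvalues * star U * U := congrArg (· * U) h
      _ = U * diagonal hG.eigenvalues := by rw [Matrix.mul_assoc _ (star U), hU, Matrix.mul_one]
  refine ⟨C⁻¹ * U, hG.eigenvalues,
    (isUnit_nonsing_inv_iff.mpr hCu).mul (IsUnit.of_mul_eq_one_right _ hU), ?_⟩
  rw [Matrix.mul_assoc C⁻¹, ← hGU, Matrix.mul_assoc, Matrix.mul_assoc,
    nonsing_inv_mul_cancel_left _ _ hdet]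

/-- A matrix which is diagonalizable over `ℝ` has a complex eigenvector in the kernel of a real
matrix only if it has a real one. -/
theorem Matrix.exists_real_eigenvector_of_complex {A B P : Matrix n n ℝ} {l : n → ℝ}
    (hP : IsUnit P) (hAP : A * P = P * diagonal l) {v : n → ℂ} (hv : v ≠ 0) {μ : ℂ}
    (hA : (A.map Complex.ofReal) *ᵥ v = μ • v) (hB : (B.map Complex.ofReal) *ᵥ v = 0) :
    ∃ x : n → ℝ, x ≠ 0 ∧ (∃ r : ℝ, A *ᵥ x = r • x) ∧ B *ᵥ x = 0 := by
  have hdet := (isUnit_iff_isUnit_det _).mp hP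
  have hre (M : Matrix n n ℝ) (w : n → ℂ) (i : n) :
      ((M.map Complex.ofReal *ᵥ w) i).re = (M *ᵥ fun j => (w j).re) i := by
    simp [mulVec, dotProduct]
  have him (M : Matrix n n ℝ) (w : n → ℂ) (i : n) :
      ((M.map Complex.ofReal *ᵥ w) i).im = (M *ᵥ fun j => (w j).im) i := by
    simp [mulVec, dotProduct]
  have hmap (M N : Matrix n n ℝ) :
      (M * N).map Complex.ofReal = M.map Complex.ofReal * N.map Complex.ofReal :=
    Matrix.map_mul (f := Complex.ofRealHom)
  have hone : (1 : Matrix n n ℝ).map Complex.ofReal = 1 := by simp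
  have hPA : P⁻¹ * A = diagonal l * P⁻¹ := by
    rw [← mul_nonsing_inv_cancel_right P (P⁻¹ * A) hdet, Matrix.mul_assoc P⁻¹, hAP,
      nonsing_inv_mul_cancel_left _ _ hdet]
  set w := (P⁻¹).map Complex.ofReal *ᵥ v
  have hw0 : w ≠ 0 := fun hw => hv <| by
    rw [← one_mulVec v, ← hone, ← mul_nonsing_inv P hdet, hmap, ← mulVec_mulVec]
    change _ *ᵥ w = 0
    rw [hw, mulVec_zero]
  have hw : (diagonal l).map Complex.ofReal *ᵥ w = μ • w := by
    rw [mulVec_mulVec, ← hmap, ← hPA, hmap, ← mulVec_mulVec, hA, mulVec_smul]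
  obtain ⟨i, hi⟩ := Function.ne_iff.mp hw0
  have hμ : μ = l i := by
    have := congrFun hw i
    rw [diagonal_map (by simp), mulVec_diagonal] at this
    exact (mul_right_cancel₀ hi this).symm
  subst hμ
  by_cases hr : (fun j => (v j).re) = 0
  · refine ⟨fun j => (v j).im, fun h => hv ?_, ⟨l i, ?_⟩, ?_⟩
    · ext j
      exact Complex.ext (congrFun hr j) (congrFun h j)
    · ext j
      rw [← him, hA]
      simp
    · ext j
      rw [← him, hB]
      simp
  · refine ⟨fun j => (v j).re, hr, ⟨l i, ?_⟩, ?_⟩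
    · ext j
      rw [← hre, hA]
      simp
    · ext j
      rw [← hre, hB]
      simp

/-- If no real eigenvector of a real-diagonalizable matrix `A` is in the kernel of the positive
semidefinite matrix `D`, then a skew-symmetric compensating matrix exists. -/
theorem Matrix.PosSemidef.exists_compensating {A D P : Matrix n n ℝ} {l : n → ℝ}
    (hD : D.PosSemidef) (hP : IsUnit P) (hAP : A * P = P * diagonal l)
    (h : ∀ (x : n → ℝ) (r : ℝ), x ≠ 0 → A *ᵥ x = r • x → D *ᵥ x ≠ 0) :
    ∃ K : Matrix n n ℝ, Kᵀ = -K ∧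
      (((1 : ℝ) / 2) • ((D - K * A) + (D - K * A)ᵀ)).PosDef := by
  have hdet := (isUnit_iff_isUnit_det _).mp hP
  have hdett : IsUnit Pᵀ.det := by rwa [det_transpose]
  set D' := Pᵀ * D * P
  have hD' : D'.PosSemidef := hD.conjTranspose_mul_mul_same P
  have hDsymm (i j : n) : D' j i = D' i j := hD'.isHermitian.apply i j
  set L : Matrix n n ℝ := Matrix.of fun i j => 2 * D' i j / (l j - l i)
  have hL : Lᵀ = -L := by
    ext i j
    simp only [L, transpose_apply, of_apply, Matrix.neg_apply, hDsymm i j]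
    rw [← neg_sub (l j) (l i), div_neg]
  refine ⟨(P⁻¹)ᵀ * L * P⁻¹, ?_, ?_⟩
  · simp only [transpose_mul, transpose_transpose, hL, Matrix.mul_assoc, Matrix.neg_mul,
      Matrix.mul_neg]
  · rw [← hP.posDef_star_left_conjugate_iff, star_eq_conjTranspose,
      conjTranspose_eq_transpose_of_trivial]
    have hconj : Pᵀ * (D - (P⁻¹)ᵀ * L * P⁻¹ * A) * P = D' - L * diagonal l := by
      rw [Matrix.mul_sub, Matrix.sub_mul, transpose_nonsing_inv, Matrix.mul_assoc Pᵀ (_ * A) P,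
        Matrix.mul_assoc _ A P, hAP, Matrix.mul_assoc _ P⁻¹, nonsing_inv_mul_cancel_left _ _ hdet,
        Matrix.mul_assoc _ L, mul_nonsing_inv_cancel_left _ _ hdett]
    have hconjt : Pᵀ * (D - (P⁻¹)ᵀ * L * P⁻¹ * A)ᵀ * P = (D' - L * diagonal l)ᵀ := by
      rw [← hconj, transpose_mul, transpose_mul, transpose_transpose, Matrix.mul_assoc]
    rw [Matrix.mul_smul, Matrix.smul_mul, Matrix.mul_add, Matrix.add_mul, hconj, hconjt]
    convert hD'.posDef_fiberwise l fun μ x hx hsupp h0 => ?_ using 1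
    · ext i j
      simp only [L, smul_apply, add_apply, sub_apply, transpose_apply, mul_diagonal, of_apply,
        smul_eq_mul, hDsymm i j]
      split_ifs with hij
      · simp [hij]
        ring
      · have h1 : l j - l i ≠ 0 := sub_ne_zero.mpr (Ne.symm hij)
        have h2 : l i - l j ≠ 0 := sub_ne_zero.mpr hij
        field_simp
        ring
    · refine h (P *ᵥ x) μ (fun hPx => hx ?_) ?_ ?_
      · exact mulVec_injective_of_isUnit hP (by rw [hPx, mulVec_zero])
      · rw [mulVec_mulVec, hAP, ← mulVec_mulVec, ← mulVec_smul]
        congr 1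
        ext i
        rw [mulVec_diagonal]
        by_cases hi : l i = μ
        · simp [hi]
        · simp [hsupp i hi]
      · refine mulVec_injective_of_isUnit (P.isUnit_transpose.mpr hP) ?_
        rwa [mulVec_zero, mulVec_mulVec, mulVec_mulVec]

end Compensation

/-- Equivalence of genuine coupling (K0) and the existence of a real
skew-symmetric compensating matrix `K` (hyperbolic compensation (K2)) for a
symmetrizable hyperbolic–parabolic pair `(A, B)` with symmetrizer `A⁰`. -/
theorem stmt_3 (n : ℕ) (A0 A B : Matrix (Fin n) (Fin n) ℝ)
    (hA0 : A0.PosDef) (hA0A : (A0 * A).IsSymm) (hA0B : (A0 * B).PosSemidef) :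
    (¬ ∃ v : Fin n → ℂ, v ≠ 0 ∧
        (∃ μ : ℂ, (A.map Complex.ofReal).mulVec v = μ • v) ∧
        (B.map Complex.ofReal).mulVec v = 0) ↔
    (∃ K : Matrix (Fin n) (Fin n) ℝ, Kᵀ = -K ∧
      (((1 : ℝ) / 2) • ((A0 * B - K * A) + (A0 * B - K * A)ᵀ)).PosDef) := by
  obtain ⟨P, l, hP, hAP⟩ := hA0.exists_isUnit_mul_diagonal hA0A
  have hker (x : Fin n → ℝ) : (A0 * B) *ᵥ x = 0 ↔ B *ᵥ x = 0 := by
    rw [← mulVec_mulVec]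
    exact (mulVec_injective_of_isUnit hA0.isUnit).eq_iff' (mulVec_zero A0)
  constructor
  · intro h
    refine hA0B.exists_compensating hP hAP fun x r hx hAx hBx => h ?_
    have hmap (M : Matrix (Fin n) (Fin n) ℝ) (i : Fin n) :
        (M.map Complex.ofReal *ᵥ fun j => (x j : ℂ)) i = ((M *ᵥ x) i : ℂ) := by
      simp [mulVec, dotProduct]
    refine ⟨fun i => x i, fun hx0 => hx ?_, ⟨r, ?_⟩, ?_⟩
    · ext i
      exact Complex.ofReal_eq_zero.mp (congrFun hx0 i)
    · ext i
      rw [hmap, hAx]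
      simp
    · ext i
      rw [hmap, (hker x).mp hBx]
      simp
  · rintro ⟨K, hK, hpos⟩ ⟨v, hv, ⟨μ, hAv⟩, hBv⟩
    obtain ⟨x, hx, ⟨r, hAx⟩, hBx⟩ := exists_real_eigenvector_of_complex hP hAP hv hAv hBv
    exact mulVec_ne_zero_of_compensating hK hpos hx hAx ((hker x).mpr hBx)
end

section
/- Let A⁰, A¹, …, A^d and B^{jk} (1 ≤ j,k ≤ d) be real n×n matrices such that: A⁰ is symmetric positive definite; A⁰A^j is symmetric for each j; for every ξ ∈ ℝ^d the matrix A⁰ ∑_{j,k} ξ_j ξ_k B^{jk} is symmetric positive semidefinite; and the genuine coupling condition holds: for every nonzero ξ ∈ ℝ^d there is no nonzero v ∈ ℂⁿ with (∑_j ξ_j A^j)v = μv for some μ ∈ ℂ and (∑_{j,k} ξ_j ξ_k B^{jk})v = 0. Then there exists θ > 0 such that for every ξ ∈ ℝ^d, every eigenvalue λ ∈ ℂ of the complex matrix −i ∑_j ξ_j A^j − ∑_{j,k} ξ_j ξ_k B^{jk} satisfies Re λ ≤ −θ‖ξ‖²/(1+‖ξ‖²). -/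
open Matrix

/-- A positive operator satisfies `T² ≤ ‖T‖ T`. -/
lemma ContinuousLinearMap.IsPositive.norm_sq_apply_le {E : Type*} [NormedAddCommGroup E]
    [InnerProductSpace ℂ E] {T : E →L[ℂ] E} (hT : T.IsPositive) (v : E) :
    ‖T v‖ ^ 2 ≤ ‖T‖ * (inner ℂ v (T v)).re := by
  rcases (norm_nonneg T).eq_or_lt with h | h
  · simp [norm_eq_zero.mp h.symm]
  set w := T v with hw
  have hquad : ∀ t : ℝ, 0 ≤ (inner ℂ v w).re - 2 * t * ‖w‖ ^ 2 + t ^ 2 * (inner ℂ w (T w)).re := by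
    intro t
    have hpos := hT.re_inner_nonneg_right (v - (t : ℂ) • w)
    have hvw : inner ℂ v (T w) = inner ℂ w w := (hT.inner_left_eq_inner_right v w).symm
    have hww : inner ℂ w w = ((‖w‖ ^ 2 : ℝ) : ℂ) := by
      rw [inner_self_eq_norm_sq_to_K]; simp
    simp only [map_sub, map_smul, ← hw, inner_sub_left, inner_sub_right, inner_smul_left,
      inner_smul_right, hvw, hww, Complex.conj_ofReal, RCLike.re_eq_complex_re, Complex.sub_re,
      Complex.re_ofReal_mul, Complex.ofReal_re] at hpos
    linarith
  have hbound : (inner ℂ w (T w)).re ≤ ‖T‖ * ‖w‖ ^ 2 := by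
    calc (inner ℂ w (T w)).re ≤ ‖w‖ * ‖T w‖ := re_inner_le_norm (𝕜 := ℂ) w (T w)
      _ ≤ ‖w‖ * (‖T‖ * ‖w‖) := by gcongr; exact T.le_opNorm w
      _ = ‖T‖ * ‖w‖ ^ 2 := by ring
  have h1 := hquad ‖T‖⁻¹
  have h2 : ‖T‖⁻¹ ^ 2 * (inner ℂ w (T w)).re ≤ ‖T‖⁻¹ ^ 2 * (‖T‖ * ‖w‖ ^ 2) := by gcongr
  have h3 : ‖T‖⁻¹ ^ 2 * (‖T‖ * ‖w‖ ^ 2) = ‖T‖⁻¹ * ‖w‖ ^ 2 := by field_simp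
  have h4 : ‖T‖⁻¹ * ‖w‖ ^ 2 ≤ (inner ℂ v w).re := by linarith
  rwa [inv_mul_le_iff₀ h] at h4

lemma ContinuousLinearMap.IsPositive.apply_eq_zero {E : Type*} [NormedAddCommGroup E]
    [InnerProductSpace ℂ E] {T : E →L[ℂ] E} (hT : T.IsPositive) {v : E}
    (h : (inner ℂ v (T v)).re = 0) : T v = 0 := by
  have := hT.norm_sq_apply_le v
  rw [h, mul_zero] at this
  exact norm_eq_zero.mp (pow_eq_zero_iff two_ne_zero |>.mp (le_antisymm this (sq_nonneg _)))

lemma LinearMap.IsSymmetric.inner_apply_self_eq_re {E : Type*} [NormedAddCommGroup E]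
    [InnerProductSpace ℂ E] {T : E →ₗ[ℂ] E} (hT : T.IsSymmetric) (v : E) :
    inner ℂ v (T v) = ((inner ℂ v (T v)).re : ℂ) := by
  refine (Complex.conj_eq_iff_re.mp ?_).symm
  rw [inner_conj_symm, hT v v]

/-- Uniform dissipativity of the generalized eigenvalue problem
`-(i r S + r² M) v = l P v`, for `S` and `M` depending continuously on a compact parameter. -/
theorem exists_uniform_dissipativity {X E : Type*} [TopologicalSpace X] [CompactSpace X]
    [NormedAddCommGroup E] [InnerProductSpace ℂ E] [FiniteDimensional ℂ E]
    {P : E →L[ℂ] E} {S M : X → E →L[ℂ] E}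
    (hP : P.IsPositive) (hP_inj : ∀ v, P v = 0 → v = 0)
    (hS_cont : Continuous S) (hM_cont : Continuous M)
    (hS : ∀ x, (S x).IsSymmetric) (hM : ∀ x, (M x).IsPositive)
    (hGC : ∀ x v (μ : ℂ), S x v = μ • P v → M x v = 0 → v = 0) :
    ∃ θ > 0, ∀ x (r : ℝ) (l : ℂ) (v : E), r ≠ 0 → v ≠ 0 →
      -((Complex.I * r) • S x v) - ((r : ℂ) ^ 2) • M x v = l • P v →
      l.re ≤ -θ * r ^ 2 / (1 + r ^ 2) := by
  have hP_pos : ∀ v, v ≠ 0 → 0 < (inner ℂ v (P v)).re := fun v hv =>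
    lt_of_le_of_ne (hP.re_inner_nonneg_right v) fun h => hv (hP_inj v (hP.apply_eq_zero h.symm))
  -- `L v` kills `P v`, and `L v (S x v)` vanishes only if `S x v` is a multiple of `P v`.
  let L : E → E → E := fun v w => inner ℂ v (P v) • w - inner ℂ v w • P v
  let f : X × E → ℝ := fun p => (inner ℂ p.2 (M p.1 p.2)).re + ‖L p.2 (S p.1 p.2)‖ ^ 2
  have hf : Continuous f := by
    have hS' : Continuous fun p : X × E => S p.1 p.2 := by fun_prop
    have hM' : Continuous fun p : X × E => M p.1 p.2 := by fun_prop
    have hre : Continuous fun p : X × E => (inner ℂ p.2 (M p.1 p.2)).re :=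
      Complex.continuous_re.comp (continuous_snd.inner hM')
    have hL : Continuous fun p : X × E => L p.2 (S p.1 p.2) :=
      ((continuous_snd.inner (P.continuous.comp continuous_snd)).smul hS').sub
        ((continuous_snd.inner hS').smul (P.continuous.comp continuous_snd))
    exact hre.add (hL.norm.pow 2)
  have : ProperSpace E := FiniteDimensional.proper ℂ E
  obtain ⟨c, hc, hcf⟩ := (isCompact_univ.prod (isCompact_sphere (0 : E) 1)).exists_forall_le'
    (hf.continuousOn) (a := 0) (by
      rintro ⟨x, v⟩ ⟨-, hv⟩
      have hv0 : v ≠ 0 := by rintro rfl; simp at hv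
      have h1 : 0 ≤ (inner ℂ v (M x v)).re := (hM x).re_inner_nonneg_right v
      have h2 := sq_nonneg ‖L v (S x v)‖
      refine lt_of_le_of_ne (add_nonneg h1 h2) fun h => hv0 ?_
      have hMv : M x v = 0 := (hM x).apply_eq_zero (by
        change 0 = _ + _ at h
        linarith)
      have hLv : L v (S x v) = 0 := by
        refine norm_eq_zero.mp (pow_eq_zero_iff two_ne_zero |>.mp (le_antisymm ?_ h2))
        change 0 = _ + _ at h
        linarith
      have hp : inner ℂ v (P v) ≠ 0 := fun h0 => (hP_pos v hv0).ne' (by rw [h0]; rfl)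
      refine hGC x v ((inner ℂ v (P v))⁻¹ * inner ℂ v (S x v)) ?_ hMv
      rw [mul_smul, ← sub_eq_zero.mp hLv, inv_smul_smul₀ hp])
  obtain ⟨K, hK⟩ := isCompact_univ.exists_bound_of_continuousOn hM_cont.continuousOn
  have hLbound : ∀ v w : E, ‖v‖ = 1 → ‖L v w‖ ≤ 2 * ‖P‖ * ‖w‖ := by
    intro v w hv
    have hPv : ‖P v‖ ≤ ‖P‖ := by simpa [hv] using P.le_opNorm v
    have h1 : ‖(inner ℂ v (P v) : ℂ)‖ ≤ ‖P‖ := by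
      have := norm_inner_le_norm (𝕜 := ℂ) v (P v)
      rw [hv, one_mul] at this
      exact this.trans hPv
    have h2 : ‖(inner ℂ v w : ℂ)‖ ≤ ‖w‖ := by
      simpa [hv] using norm_inner_le_norm (𝕜 := ℂ) v w
    calc ‖L v w‖ ≤ ‖inner ℂ v (P v) • w‖ + ‖inner ℂ v w • P v‖ := norm_sub_le _ _
      _ = ‖(inner ℂ v (P v) : ℂ)‖ * ‖w‖ + ‖(inner ℂ v w : ℂ)‖ * ‖P v‖ := by
        rw [norm_smul, norm_smul]
      _ ≤ ‖P‖ * ‖w‖ + ‖w‖ * ‖P‖ := by gcongr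
      _ = 2 * ‖P‖ * ‖w‖ := by ring
  set D : ℝ := 1 + 4 * ‖P‖ ^ 2 * |K| with hD
  have hD1 : 1 ≤ D := by rw [hD]; linarith [show 0 ≤ 4 * ‖P‖ ^ 2 * |K| by positivity]
  refine ⟨c / (D * (‖P‖ + 1)), by positivity, ?_⟩
  suffices key : ∀ x (r : ℝ) (l : ℂ) (v : E), r ≠ 0 → ‖v‖ = 1 →
      -((Complex.I * r) • S x v) - ((r : ℂ) ^ 2) • M x v = l • P v →
      l.re ≤ -(c / (D * (‖P‖ + 1))) * r ^ 2 / (1 + r ^ 2) by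
    intro x r l v hr hv h
    refine key x r l ((‖v‖⁻¹ : ℂ) • v) hr (norm_smul_inv_norm hv) ?_
    simp only [map_smul]
    rw [smul_comm l, ← h, smul_sub, smul_neg, smul_comm _ (Complex.I * (r : ℂ)),
      smul_comm _ ((r : ℂ) ^ 2)]
  intro x r l v hr hv h
  have hv0 : v ≠ 0 := by rintro rfl; simp at hv
  have hr' : (r : ℂ) ≠ 0 := Complex.ofReal_ne_zero.mpr hr
  set b := (inner ℂ v (M x v)).re with hb
  set p := (inner ℂ v (P v)).re with hp
  have hp0 : 0 < p := hP_pos v hv0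
  have hb0 : 0 ≤ b := (hM x).re_inner_nonneg_right v
  have hpP : p ≤ ‖P‖ + 1 := by
    have h1 := re_inner_le_norm (𝕜 := ℂ) v (P v)
    have h2 : ‖P v‖ ≤ ‖P‖ := by simpa [hv] using P.le_opNorm v
    rw [hv, one_mul] at h1
    exact h1.trans (h2.trans (by linarith))
  have henergy : l.re * p = -(r ^ 2 * b) := by
    have hPv := hP.isSymmetric.inner_apply_self_eq_re v
    have hSv := (hS x).inner_apply_self_eq_re v
    have h1 := congrArg (fun w => (inner ℂ v w).re) h
    simp only [inner_sub_right, inner_neg_right, inner_smul_right] at h1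
    erw [hPv, hSv] at h1
    simp only [Complex.sub_re, Complex.neg_re, Complex.re_mul_ofReal, ← Complex.ofReal_pow,
      Complex.re_ofReal_mul, Complex.I_re, zero_mul, neg_zero, zero_sub] at h1
    exact h1.symm
  have hS_eq : S x v = (Complex.I * l / r) • P v + (Complex.I * r) • M x v := by
    rw [mul_div_right_comm, mul_smul, ← h, smul_sub, smul_neg, smul_smul, smul_smul]
    have e1 : Complex.I / r * (Complex.I * r) = -1 := by
      field_simp; exact Complex.I_sq
    have e2 : Complex.I / r * (r : ℂ) ^ 2 = Complex.I * r := by field_simp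
    rw [e1, e2]
    simp
  have hLS : L v (S x v) = (Complex.I * r) • L v (M x v) := by
    simp only [L, hS_eq, inner_add_right, inner_smul_right]
    module
  have hMv : ‖M x v‖ ^ 2 ≤ |K| * b := by
    refine ((hM x).norm_sq_apply_le v).trans ?_
    gcongr
    exact (hK x trivial).trans (le_abs_self K)
  have hLS' : ‖L v (S x v)‖ ^ 2 ≤ r ^ 2 * (4 * ‖P‖ ^ 2 * (|K| * b)) := by
    have h1 := hLbound v (M x v) hv
    calc ‖L v (S x v)‖ ^ 2 = r ^ 2 * ‖L v (M x v)‖ ^ 2 := by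
          rw [hLS, norm_smul, mul_pow]; simp
      _ ≤ r ^ 2 * (2 * ‖P‖ * ‖M x v‖) ^ 2 := by gcongr
      _ = r ^ 2 * (4 * ‖P‖ ^ 2 * ‖M x v‖ ^ 2) := by ring
      _ ≤ _ := by gcongr
  have hcb : c ≤ D * (1 + r ^ 2) * b := by
    have h1 : c ≤ b + ‖L v (S x v)‖ ^ 2 := hcf (x, v) ⟨trivial, by simpa using hv⟩
    have h2 : 0 ≤ 4 * ‖P‖ ^ 2 * |K| * b := by positivity
    have h3 : 0 ≤ r ^ 2 * b := by positivity
    calc c ≤ b + r ^ 2 * (4 * ‖P‖ ^ 2 * (|K| * b)) := h1.trans (by gcongr)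
      _ ≤ D * (1 + r ^ 2) * b := by rw [hD]; linarith
  have hl : l.re = -(r ^ 2 * b) / p := by rw [← henergy]; field_simp
  have hfin : c / (D * (‖P‖ + 1)) * r ^ 2 / (1 + r ^ 2) ≤ r ^ 2 * b / p := by
    calc c / (D * (‖P‖ + 1)) * r ^ 2 / (1 + r ^ 2)
        ≤ (D * (1 + r ^ 2) * b) / (D * (‖P‖ + 1)) * r ^ 2 / (1 + r ^ 2) := by gcongr
      _ = r ^ 2 * b / (‖P‖ + 1) := by field_simp
      _ ≤ r ^ 2 * b / p := by gcongr
  rw [hl, neg_div, neg_mul, neg_div]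
  exact neg_le_neg hfin

open scoped ComplexOrder in
lemma Matrix.PosSemidef.map_ofReal {n : Type*} [Fintype n] [DecidableEq n] {A : Matrix n n ℝ}
    (hA : A.PosSemidef) : (A.map Complex.ofReal).PosSemidef := by
  obtain ⟨y, rfl⟩ : ∃ y : Matrix n n ℝ, A = yᴴ * y := by
    open scoped MatrixOrder in
    exact CStarAlgebra.nonneg_iff_eq_star_mul_self.mp hA.nonneg
  have h : (yᴴ * y).map Complex.ofReal = (y.map Complex.ofReal)ᴴ * y.map Complex.ofReal := by
    ext i j
    simp [Matrix.mul_apply]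
  rw [h]
  exact Matrix.posSemidef_conjTranspose_mul_self _

lemma Matrix.IsSymm.isHermitian_map_ofReal {n : Type*} {A : Matrix n n ℝ}
    (hA : A.IsSymm) : (A.map Complex.ofReal).IsHermitian := by
  ext i j
  simp [hA.apply i j]

lemma Matrix.exists_mulVec_eq_smul_of_mem_spectrum {n : Type*} [Fintype n] [DecidableEq n]
    {C : Matrix n n ℂ} {l : ℂ} (hl : l ∈ spectrum ℂ C) : ∃ v ≠ 0, C *ᵥ v = l • v := by
  rw [← Matrix.spectrum_toLin', ← Module.End.hasEigenvalue_iff_mem_spectrum] at hl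
  obtain ⟨v, hv⟩ := hl.exists_hasEigenvector
  exact ⟨v, hv.2, by simpa using hv.apply_eq_smul⟩

lemma Matrix.isPositive_toEuclideanCLM_map_ofReal {n : Type*} [Fintype n] [DecidableEq n]
    {A : Matrix n n ℝ} (hA : A.PosSemidef) :
    (toEuclideanCLM (𝕜 := ℂ) (A.map Complex.ofReal)).IsPositive :=
  (isPositive_toEuclideanLin_iff.mpr hA.map_ofReal :)

lemma Matrix.isSymmetric_toEuclideanCLM_map_ofReal {n : Type*} [Fintype n] [DecidableEq n]
    {A : Matrix n n ℝ} (hA : A.IsSymm) :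
    (toEuclideanCLM (𝕜 := ℂ) (A.map Complex.ofReal)).IsSymmetric :=
  (isSymmetric_toEuclideanLin_iff.mpr hA.isHermitian_map_ofReal :)

lemma Matrix.continuous_toEuclideanCLM {n : Type*} [Fintype n] [DecidableEq n] :
    Continuous (toEuclideanCLM (n := n) (𝕜 := ℂ)) :=
  LinearMap.continuous_of_finiteDimensional
    (toEuclideanCLM (n := n) (𝕜 := ℂ)).toAlgEquiv.toLinearMap

/-- Uniform multi-dimensional strict dissipativity of the symbol
`-i ∑ ξⱼ Aʲ - ∑ ξⱼξₖ Bʲᵏ` under symmetrizability and genuine coupling (GC). -/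
theorem stmt_4 (d n : ℕ) (A0 : Matrix (Fin n) (Fin n) ℝ)
    (A : Fin d → Matrix (Fin n) (Fin n) ℝ)
    (B : Fin d → Fin d → Matrix (Fin n) (Fin n) ℝ)
    (hA0 : A0.PosDef)
    (hA0A : ∀ j, (A0 * A j).IsSymm)
    (hA0B : ∀ ξ : Fin d → ℝ, (A0 * ∑ j, ∑ k, (ξ j * ξ k) • B j k).PosSemidef)
    (hGC : ∀ ξ : Fin d → ℝ, ξ ≠ 0 →
      ¬ ∃ v : Fin n → ℂ, v ≠ 0 ∧
        (∃ μ : ℂ, ((∑ j, ξ j • A j).map Complex.ofReal).mulVec v = μ • v) ∧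
        ((∑ j, ∑ k, (ξ j * ξ k) • B j k).map Complex.ofReal).mulVec v = 0) :
    ∃ θ > 0, ∀ ξ : Fin d → ℝ, ∀ l ∈ spectrum ℂ
        ((-Complex.I) • ((∑ j, ξ j • A j).map Complex.ofReal) -
          (∑ j, ∑ k, (ξ j * ξ k) • B j k).map Complex.ofReal),
      l.re ≤ -θ * (∑ j, ξ j ^ 2) / (1 + ∑ j, ξ j ^ 2) := by
  let a : (Fin d → ℝ) → Matrix (Fin n) (Fin n) ℝ := fun ξ => ∑ j, ξ j • A j
  let b : (Fin d → ℝ) → Matrix (Fin n) (Fin n) ℝ := fun ξ => ∑ j, ∑ k, (ξ j * ξ k) • B j k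
  have ha_smul : ∀ (r : ℝ) ξ, a (r • ξ) = r • a ξ := fun r ξ => by
    simp [a, Finset.smul_sum, mul_smul]
  have hb_smul : ∀ (r : ℝ) ξ, b (r • ξ) = r ^ 2 • b ξ := fun r ξ => by
    simp only [b, Finset.smul_sum, smul_smul, Pi.smul_apply, smul_eq_mul]
    exact Finset.sum_congr rfl fun j _ => Finset.sum_congr rfl fun k _ => by congr 1; ring
  have hinj : ∀ w : Fin n → ℂ, A0.map Complex.ofReal *ᵥ w = 0 → w = 0 := by
    have hu : IsUnit (A0.map Complex.ofReal) := hA0.isUnit.map Complex.ofRealHom.mapMatrix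
    intro w hw
    exact mulVec_injective_iff_isUnit.mpr hu (hw.trans (mulVec_zero _).symm)
  have hmap_mul : ∀ C D : Matrix (Fin n) (Fin n) ℝ,
      (C * D).map Complex.ofReal = C.map Complex.ofReal * D.map Complex.ofReal :=
    fun C D => Matrix.map_mul (f := Complex.ofRealHom)
  have hmap_smul : ∀ (r : ℝ) (C : Matrix (Fin n) (Fin n) ℝ),
      (r • C).map Complex.ofReal = (r : ℂ) • C.map Complex.ofReal := fun r C => by
    ext i j; simp
  obtain ⟨θ, hθ, hmain⟩ := exists_uniform_dissipativity
    (X := Metric.sphere (0 : EuclideanSpace ℝ (Fin d)) 1)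
    (P := toEuclideanCLM (𝕜 := ℂ) (A0.map Complex.ofReal))
    (S := fun ω => toEuclideanCLM (𝕜 := ℂ) ((A0 * a ω.1.ofLp).map Complex.ofReal))
    (M := fun ω => toEuclideanCLM (𝕜 := ℂ) ((A0 * b ω.1.ofLp).map Complex.ofReal))
    (isPositive_toEuclideanCLM_map_ofReal hA0.posSemidef)
    (fun v hv => by
      have h1 := congrArg WithLp.ofLp hv
      rw [ofLp_toEuclideanCLM] at h1
      exact (WithLp.ofLp_eq_zero 2).mp (hinj _ h1))
    (continuous_toEuclideanCLM.comp
      (Continuous.matrix_map (by fun_prop) Complex.continuous_ofReal))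
    (continuous_toEuclideanCLM.comp
      (Continuous.matrix_map (by fun_prop) Complex.continuous_ofReal))
    (fun ω => isSymmetric_toEuclideanCLM_map_ofReal (by
      simp only [IsSymm, a, Finset.mul_sum, transpose_sum, transpose_smul,
        fun j => (hA0A j).eq, mul_smul_comm]))
    (fun ω => isPositive_toEuclideanCLM_map_ofReal (hA0B _))
    (by
      intro ω v μ hS hM
      have h1 := congrArg WithLp.ofLp hS
      have h2 := congrArg WithLp.ofLp hM
      rw [WithLp.ofLp_smul, ofLp_toEuclideanCLM, ofLp_toEuclideanCLM, hmap_mul, ← mulVec_mulVec,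
        ← mulVec_smul, ← sub_eq_zero, ← mulVec_sub] at h1
      rw [ofLp_toEuclideanCLM, hmap_mul, ← mulVec_mulVec] at h2
      by_contra hv
      refine hGC ω.1.ofLp (fun h0 => ?_)
        ⟨v.ofLp, fun h => hv ((WithLp.ofLp_eq_zero 2).mp h),
          ⟨μ, sub_eq_zero.mp (hinj _ h1)⟩, hinj _ h2⟩
      have := ω.2
      rw [(WithLp.ofLp_eq_zero 2).mp h0] at this
      simp at this)
  refine ⟨θ, hθ, fun ξ l hl => ?_⟩
  obtain ⟨v, hv, hlv⟩ := exists_mulVec_eq_smul_of_mem_spectrum hl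
  change (-Complex.I • (a ξ).map Complex.ofReal - (b ξ).map Complex.ofReal) *ᵥ v = l • v at hlv
  rcases eq_or_ne ξ 0 with rfl | hξ
  · have ha0 : a 0 = 0 := by simp [a]
    have hb0 : b 0 = 0 := by simp [b]
    have hl0 : l = 0 := by
      rw [ha0, hb0] at hlv
      simpa [hv, eq_comm] using hlv
    simp [hl0]
  set x : EuclideanSpace ℝ (Fin d) := WithLp.toLp 2 ξ with hx
  have hx0 : ‖x‖ ≠ 0 := norm_ne_zero_iff.mpr fun h => hξ ((WithLp.toLp_eq_zero 2).mp h)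
  have hsq : ∑ j, ξ j ^ 2 = ‖x‖ ^ 2 := (EuclideanSpace.real_norm_sq_eq x).symm
  have hξω : ξ = ‖x‖ • (‖x‖⁻¹ • x).ofLp := by
    rw [WithLp.ofLp_smul, smul_smul, mul_inv_cancel₀ hx0, one_smul]
  rw [hsq]
  refine hmain ⟨‖x‖⁻¹ • x, by simp [norm_smul, hx0]⟩ ‖x‖ l (WithLp.toLp 2 v) hx0
    (fun h => hv ((WithLp.toLp_eq_zero 2).mp h)) ?_
  apply WithLp.ofLp_injective 2
  simp only [WithLp.ofLp_sub, WithLp.ofLp_neg, WithLp.ofLp_smul, ofLp_toEuclideanCLM, hmap_mul,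
    ← mulVec_mulVec, ← mulVec_smul, ← hlv]
  conv_rhs => rw [hξω, ha_smul, hb_smul, hmap_smul, hmap_smul]
  simp only [sub_mulVec, smul_mulVec, mulVec_sub, mulVec_smul, smul_smul, Complex.ofReal_pow,
    neg_mul, neg_smul, neg_mulVec, mulVec_neg, WithLp.ofLp_smul]
end

section
/- Let A and B be real n×n matrices with A symmetric, let τ₀ be a simple eigenvalue of A (algebraic multiplicity one), and let r ∈ ℝⁿ be a unit vector with Ar = τ₀ r. Suppose there exist θ₁ > 0 and ρ₀ > 0 such that for every ρ ∈ (0, ρ₀), every eigenvalue μ ∈ ℂ of the complex matrix −iA − ρB satisfies Re μ ≤ −θ₁ρ. Then rᵀ B r ≥ θ₁. -/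
open Matrix

/-- If `τ` has algebraic multiplicity at most one, its eigenspace is spanned by any
nonzero eigenvector. -/
lemma Matrix.exists_eq_smul_of_rootMultiplicity_le_one {K ι : Type*} [Field K] [Fintype ι]
    [DecidableEq ι] (M : Matrix ι ι K) {τ : K} (hτ : M.charpoly.rootMultiplicity τ ≤ 1)
    {v w : ι → K} (hv0 : v ≠ 0) (hv : M *ᵥ v = τ • v) (hw : M *ᵥ w = τ • w) :
    ∃ c : K, w = c • v := by
  have hdim : Module.finrank K (Module.End.eigenspace (toLin' M) τ) ≤ 1 := by
    refine (LinearMap.finrank_eigenspace_le _ _).trans ?_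
    rwa [Matrix.charpoly_toLin']
  have mem {u : ι → K} (hu : M *ᵥ u = τ • u) : u ∈ Module.End.eigenspace (toLin' M) τ := by
    rwa [Module.End.mem_eigenspace_iff, toLin'_apply]
  have hone : Module.finrank K (Module.End.eigenspace (toLin' M) τ) = 1 :=
    le_antisymm hdim <| Module.finrank_pos_iff_exists_ne_zero.mpr
      ⟨⟨v, mem hv⟩, fun h => hv0 (congrArg Subtype.val h)⟩
  obtain ⟨c, hc⟩ := exists_smul_eq_of_finrank_eq_one hone
    (x := ⟨v, mem hv⟩) (fun h => hv0 (congrArg Subtype.val h)) ⟨w, mem hw⟩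
  exact ⟨c, (congrArg Subtype.val hc).symm⟩

/-- Perturbation of a simple zero eigenvalue: if `v` spans the kernel of `C` and `l` is a left
null vector with `l ⬝ᵥ v = 1`, then for small `ρ` the matrix `C - ρ • B` has an eigenvector
`x ρ → v`, normalized by `l`, with eigenvalue `-ρ * (l ⬝ᵥ B *ᵥ x ρ)`. -/
lemma Matrix.exists_eigenvector_perturbation {𝕜 ι : Type*} [RCLike 𝕜] [Fintype ι]
    (C B : Matrix ι ι 𝕜) {l v : ι → 𝕜} (hlv : l ⬝ᵥ v = 1) (hl : l ᵥ* C = 0) (hv : C *ᵥ v = 0)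
    (hker : ∀ w, C *ᵥ w = 0 → ∃ c : 𝕜, w = c • v) :
    ∃ x : 𝕜 → ι → 𝕜, Filter.Tendsto x (nhds 0) (nhds v) ∧ ∀ᶠ ρ in nhds 0,
      l ⬝ᵥ x ρ = 1 ∧ (C - ρ • B) *ᵥ x ρ = (-ρ * (l ⬝ᵥ B *ᵥ x ρ)) • x ρ := by
  let CL := (Matrix.mulVecLin C).toContinuousLinearMap
  let BL := (Matrix.mulVecLin B).toContinuousLinearMap
  let L : (ι → 𝕜) →L[𝕜] 𝕜 := (dotProductBilin 𝕜 𝕜 l).toContinuousLinearMap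
  let P := ContinuousLinearMap.fst 𝕜 𝕜 ((ι → 𝕜) × 𝕜)
  let Q := (ContinuousLinearMap.fst 𝕜 (ι → 𝕜) 𝕜).comp (.snd 𝕜 𝕜 ((ι → 𝕜) × 𝕜))
  let R := (ContinuousLinearMap.snd 𝕜 (ι → 𝕜) 𝕜).comp (.snd 𝕜 𝕜 ((ι → 𝕜) × 𝕜))
  let G (p : 𝕜 × (ι → 𝕜) × 𝕜) : 𝕜 × (ι → 𝕜) × 𝕜 :=
    (P p, (CL.comp Q) p - P p • (BL.comp Q) p - R p • Q p, (L.comp Q) p)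
  let D := P.prod ((CL.comp Q - P.smulRight (B *ᵥ v) - R.smulRight v).prod (L.comp Q))
  have hG : HasStrictFDerivAt G D (0, v, 0) := by
    refine HasStrictFDerivAt.congr_fderiv ((P.hasStrictFDerivAt (x := (0, v, 0))).prodMk
      ((((CL.comp Q).hasStrictFDerivAt.sub
        (P.hasStrictFDerivAt.smul (BL.comp Q).hasStrictFDerivAt)).sub
        (R.hasStrictFDerivAt.smul Q.hasStrictFDerivAt)).prodMk
        (L.comp Q).hasStrictFDerivAt)) ?_
    refine ContinuousLinearMap.ext fun p => ?_
    simp [D, P, Q, R, BL]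
  have hDinj : Function.Injective D.toLinearMap := by
    rw [← LinearMap.ker_eq_bot, LinearMap.ker_eq_bot']
    rintro ⟨ρ, w, ν⟩ h
    have hρ : ρ = 0 := congrArg Prod.fst h
    subst hρ
    have h1 : C *ᵥ w - ν • v = 0 := by
      simpa [D, P, Q, R, CL, BL] using congrArg (fun p => p.2.1) h
    have h2 : l ⬝ᵥ w = 0 := congrArg (fun p => p.2.2) h
    have hν : ν = 0 := by
      simpa [dotProduct_sub, dotProduct_mulVec, hl, hlv] using congrArg (l ⬝ᵥ ·) h1
    subst hν
    obtain ⟨c, rfl⟩ := hker w (by simpa using h1)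
    have hc : c = 0 := by simpa [hlv] using h2
    simp [hc]
  let e := (LinearEquiv.ofInjectiveEndo D.toLinearMap hDinj).toContinuousLinearEquiv
  have he : (e : 𝕜 × (ι → 𝕜) × 𝕜 →L[𝕜] 𝕜 × (ι → 𝕜) × 𝕜) = D := by
    ext1 <;> rfl
  rw [← he] at hG
  have hG0 : G (0, v, 0) = (0, 0, 1) := by
    simp [G, P, Q, R, CL, BL, L, hv, hlv]
  have hpath : Filter.Tendsto (fun ρ : 𝕜 => (ρ, (0 : ι → 𝕜), (1 : 𝕜))) (nhds 0)
      (nhds (G (0, v, 0))) := by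
    rw [hG0]
    exact Continuous.tendsto (by fun_prop) 0
  refine ⟨fun ρ => (hG.localInverse G e _ (ρ, 0, 1)).2.1,
    ((continuous_fst.comp continuous_snd).tendsto _).comp (hG.localInverse_tendsto.comp hpath), ?_⟩
  filter_upwards [hpath.eventually hG.eventually_right_inverse] with ρ hρ
  generalize hG.localInverse G e _ (ρ, 0, 1) = p at hρ ⊢
  obtain ⟨ρ', x, m⟩ := p
  have h0 : ρ' = ρ := congrArg Prod.fst hρ
  subst h0
  have h1 : C *ᵥ x - ρ' • B *ᵥ x - m • x = 0 := congrArg (fun p => p.2.1) hρ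
  have h2 : l ⬝ᵥ x = 1 := congrArg (fun p => p.2.2) hρ
  have hm : -(ρ' * (l ⬝ᵥ B *ᵥ x)) - m = 0 := by
    have := congrArg (l ⬝ᵥ ·) h1
    simpa only [dotProduct_sub, dotProduct_mulVec l C, hl, dotProduct_smul, h2, smul_eq_mul,
      zero_dotProduct, dotProduct_zero, zero_sub, mul_one] using this
  refine ⟨h2, ?_⟩
  rw [sub_mulVec, smul_mulVec, neg_mul, sub_eq_zero.mp hm]
  exact sub_eq_zero.mp h1

/-- Observation B of Section 5.4: uniform dissipativity of the symbol
`-iA - ρB` forces positivity `rᵀ B r ≥ θ₁` of the diffusion coefficient in the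
direction of a simple eigenmode `r` of the symmetric matrix `A`. -/
theorem stmt_5 (n : ℕ) (A B : Matrix (Fin n) (Fin n) ℝ) (hA : A.IsSymm)
    (τ₀ : ℝ) (hsimple : (Matrix.charpoly A).rootMultiplicity τ₀ = 1)
    (r : Fin n → ℝ) (hr : r ⬝ᵥ r = 1) (hAr : A.mulVec r = τ₀ • r)
    (θ₁ ρ₀ : ℝ) (hθ₁ : 0 < θ₁) (hρ₀ : 0 < ρ₀)
    (hdiss : ∀ ρ : ℝ, ρ ∈ Set.Ioo 0 ρ₀ → ∀ μ ∈ spectrum ℂ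
        ((-Complex.I) • A.map Complex.ofReal - ((ρ : ℝ) : ℂ) • B.map Complex.ofReal),
      μ.re ≤ -θ₁ * ρ) :
    θ₁ ≤ r ⬝ᵥ B.mulVec r := by
  set A' := A.map Complex.ofReal with hA'
  set B' := B.map Complex.ofReal
  set v : Fin n → ℂ := Complex.ofReal ∘ r
  have hvv : v ⬝ᵥ v = 1 := by
    rw [← Complex.ofReal_one, ← hr]
    exact (RingHom.map_dotProduct Complex.ofRealHom r r).symm
  have hAv : A' *ᵥ v = (τ₀ : ℂ) • v := by
    ext i
    have := (RingHom.map_mulVec Complex.ofRealHom A r i).symm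
    rw [hAr] at this
    exact this.trans (Complex.ofReal_mul _ _)
  have hBv : v ⬝ᵥ B' *ᵥ v = ((r ⬝ᵥ B *ᵥ r : ℝ) : ℂ) := by
    have h : B' *ᵥ v = Complex.ofRealHom ∘ (B *ᵥ r) :=
      funext fun i => (RingHom.map_mulVec Complex.ofRealHom B r i).symm
    rw [h]
    exact (RingHom.map_dotProduct Complex.ofRealHom r (B *ᵥ r)).symm
  have hv0 : v ≠ 0 := by
    intro h
    simp [h] at hvv
  have hmult : A'.charpoly.rootMultiplicity (τ₀ : ℂ) ≤ 1 := by
    have h := Polynomial.eq_rootMultiplicity_map (p := A.charpoly)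
      (f := Complex.ofRealHom) Complex.ofReal_injective τ₀
    rw [← Matrix.charpoly_map, hsimple] at h
    exact h.symm.le
  let C : Matrix (Fin n) (Fin n) ℂ := (-Complex.I) • (A' - (τ₀ : ℂ) • 1)
  have hC (w : Fin n → ℂ) : C *ᵥ w = (-Complex.I) • (A' *ᵥ w - (τ₀ : ℂ) • w) := by
    simp only [C, smul_mulVec, sub_mulVec, one_mulVec]
  have hCv : C *ᵥ v = 0 := by rw [hC, hAv, sub_self, smul_zero]
  have hCsymm : Cᵀ = C := by
    simp only [C, transpose_smul, transpose_sub, transpose_one, hA', ← transpose_map, hA.eq]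
  obtain ⟨x, hx, hev⟩ := Matrix.exists_eigenvector_perturbation C B' hvv
    (by rw [← mulVec_transpose, hCsymm, hCv]) hCv fun w hw =>
      Matrix.exists_eq_smul_of_rootMultiplicity_le_one A' hmult hv0 hAv (by
        rw [hC, smul_eq_zero_iff_right (neg_ne_zero.mpr Complex.I_ne_zero)] at hw
        exact sub_eq_zero.mp hw)
  have hreal : Filter.Tendsto (fun ρ : ℝ => (ρ : ℂ)) (nhdsWithin 0 (Set.Ioi 0)) (nhds 0) :=
    (Complex.continuous_ofReal.tendsto' 0 0 Complex.ofReal_zero).mono_left nhdsWithin_le_nhds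
  have hlim : Filter.Tendsto (fun ρ : ℝ => (v ⬝ᵥ B' *ᵥ x ρ).re) (nhdsWithin 0 (Set.Ioi 0))
      (nhds (r ⬝ᵥ B *ᵥ r)) := by
    have hcont : Continuous fun w : Fin n → ℂ => (v ⬝ᵥ B' *ᵥ w).re := by fun_prop
    have := (hcont.tendsto v).comp (hx.comp hreal)
    rwa [hBv, Complex.ofReal_re] at this
  refine ge_of_tendsto hlim ?_
  filter_upwards [hreal.eventually hev, Ioo_mem_nhdsGT hρ₀] with ρ ⟨hnorm, heig⟩ hρ
  have hx0 : x ρ ≠ 0 := by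
    intro h
    simp [h] at hnorm
  have hmem : -Complex.I * τ₀ + -(ρ : ℂ) * (v ⬝ᵥ B' *ᵥ x ρ) ∈
      spectrum ℂ ((-Complex.I) • A' - (ρ : ℂ) • B') := by
    rw [← spectrum_toLin', ← Module.End.hasEigenvalue_iff_mem_spectrum]
    refine Module.End.hasEigenvalue_of_hasEigenvector (x := x ρ)
      ⟨Module.End.mem_eigenspace_iff.mpr ?_, hx0⟩
    rw [toLin'_apply, add_smul, ← heig, sub_mulVec, sub_mulVec, hC]
    simp only [smul_mulVec, smul_sub, smul_smul]
    abel
  have hle := hdiss ρ hρ _ hmem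
  simp only [Complex.add_re, Complex.mul_re, Complex.neg_re, Complex.neg_im, Complex.I_re,
    Complex.I_im, Complex.ofReal_re, Complex.ofReal_im] at hle
  have hρpos := hρ.1
  nlinarith
end

section
/- Let A¹, …, A^d be real n×n matrices with A¹ invertible, and suppose the family is hyperbolic: for every ξ ∈ ℝ^d, all complex eigenvalues of ∑_{j=1}^d ξ_j A^j are real. Then for every (ξ₂, …, ξ_d) ∈ ℝ^{d−1} and every λ ∈ ℂ with Re λ ≠ 0, the complex matrix (A¹)⁻¹(λ I + i ∑_{j=2}^d ξ_j A^j) has no purely imaginary eigenvalue. -/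
open Matrix

/-- Hersch's lemma (Exercise 2.6): for a hyperbolic family with `A¹`
invertible, the matrix `(A¹)⁻¹(λ + i A^{ξ̃})` has no purely imaginary
eigenvalue when `Re λ ≠ 0`. -/
theorem stmt_6 (n d : ℕ) (A1 : Matrix (Fin n) (Fin n) ℝ)
    (A : Fin d → Matrix (Fin n) (Fin n) ℝ)
    (hA1 : IsUnit A1.det)
    (hhyp : ∀ (ξ1 : ℝ) (ξt : Fin d → ℝ), ∀ μ ∈ spectrum ℂ
        ((ξ1 • A1 + ∑ j, ξt j • A j).map Complex.ofReal), μ.im = 0) :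
    ∀ (ξt : Fin d → ℝ) (l : ℂ), l.re ≠ 0 →
      ∀ μ ∈ spectrum ℂ ((A1.map Complex.ofReal)⁻¹ *
          (l • (1 : Matrix (Fin n) (Fin n) ℂ) +
            Complex.I • ((∑ j, ξt j • A j).map Complex.ofReal))),
        μ.re ≠ 0 := by
  intro ξt l hl μ hμ hre
  refine hl ?_
  have key := hhyp μ.im (fun j => -ξt j) (-Complex.I * l) ?_
  · simpa using key
  have hsum : ∑ j, (-ξt j) • A j = -∑ j, ξt j • A j := by
    simp [Finset.sum_neg_distrib]
  rw [hsum]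
  generalize ∑ j, ξt j • A j = B at hμ ⊢
  have hμI : μ = Complex.I * μ.im := by
    apply Complex.ext <;> simp [hre]
  have hunit : IsUnit (A1.map Complex.ofReal) :=
    ((Matrix.isUnit_iff_isUnit_det A1).2 hA1).map Complex.ofRealHom.mapMatrix
  have hdet : IsUnit (A1.map Complex.ofReal).det :=
    (Matrix.isUnit_iff_isUnit_det _).1 hunit
  have hmap : (μ.im • A1 + -B).map Complex.ofReal =
      (μ.im : ℂ) • A1.map Complex.ofReal - B.map Complex.ofReal := by
    ext i j
    simp [sub_eq_add_neg]
  have hfactor : algebraMap ℂ (Matrix (Fin n) (Fin n) ℂ) (-Complex.I * l) -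
      (μ.im • A1 + -B).map Complex.ofReal =
      (Complex.I • A1.map Complex.ofReal) *
        (algebraMap ℂ (Matrix (Fin n) (Fin n) ℂ) μ - (A1.map Complex.ofReal)⁻¹ *
          (l • (1 : Matrix (Fin n) (Fin n) ℂ) + Complex.I • B.map Complex.ofReal)) := by
    rw [hmap, mul_sub, smul_mul_assoc, smul_mul_assoc,
      Matrix.mul_nonsing_inv_cancel_left _ _ hdet, Algebra.algebraMap_eq_smul_one,
      Algebra.algebraMap_eq_smul_one, mul_smul_comm, mul_one, smul_add, smul_smul, smul_smul,
      smul_smul, Complex.I_mul_I]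
    have hI : Complex.I * μ = -(μ.im : ℂ) := by
      conv_lhs => rw [hμI]
      rw [← mul_assoc, Complex.I_mul_I, neg_one_mul]
    rw [hI]
    module
  have hIunit : IsUnit (Complex.I • A1.map Complex.ofReal) :=
    hunit.smul (Units.mk0 Complex.I Complex.I_ne_zero)
  rw [spectrum.mem_iff] at hμ ⊢
  rwa [hfactor, hIunit.mul_left_iff]
end

section
/- Let 𝔸 : ℝ → M_N(ℂ) be continuous and let 𝔸₋ ∈ M_N(ℂ), C₁ > 0, θ > 0 satisfy ‖𝔸(x) − 𝔸₋‖ ≤ C₁ e^{θx} for all x ≤ 0. Let μ ∈ ℂ and V⁻ ∈ ℂ^N satisfy 𝔸₋V⁻ = μV⁻. Then for every θ̄ ∈ (0, θ) there exist a constant C > 0 and a continuously differentiable function V : ℝ → ℂ^N such that W(x) := e^{μx}V(x) satisfies W′(x) = 𝔸(x)W(x) for all x ∈ ℝ, and ‖V(x) − V⁻‖ ≤ C e^{θ̄x}‖V⁻‖ for all x ≤ 0. -/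
open MeasureTheory Set Filter Topology

section GapLemma

variable {E : Type*} [NormedAddCommGroup E] [NormedSpace ℂ E]

section ExponentialWeights

variable [CompleteSpace E]

theorem exists_primitive_norm_le_exp_of_pos {c M : ℝ} (hc : 0 < c) {g : ℝ → E}
    (hg : Continuous g) (hgM : ∀ x, ‖g x‖ ≤ M * Real.exp (c * x)) :
    ∃ G : ℝ → E, (∀ x, HasDerivAt G (g x) x) ∧
      (∀ x, ‖G x‖ ≤ M / c * Real.exp (c * x)) ∧
      ∀ L : E →L[ℂ] E, (∀ x, L (g x) = 0) → ∀ x, L (G x) = 0 := by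
  have hexp (x : ℝ) : IntegrableOn (fun y => M * Real.exp (c * y)) (Iic x) :=
    (integrableOn_exp_mul_Iic hc x).const_mul M
  have hint (x : ℝ) : IntegrableOn g (Iic x) :=
    (hexp x).mono' hg.aestronglyMeasurable (ae_of_all _ hgM)
  refine ⟨fun x => ∫ y in Iic x, g y, fun x => ?_, fun x => ?_, fun L hL x => ?_⟩
  · have h : (fun x => ∫ y in Iic x, g y) =
        fun x => (∫ y in Iic (0 : ℝ), g y) + ∫ y in (0 : ℝ)..x, g y := by
      funext x
      rw [← intervalIntegral.integral_Iic_sub_Iic (hint 0) (hint x), add_sub_cancel]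
    rw [h]
    exact ((hg.integral_hasStrictDerivAt 0 x).hasDerivAt).const_add _
  · calc ‖∫ y in Iic x, g y‖ ≤ ∫ y in Iic x, M * Real.exp (c * y) :=
          norm_integral_le_of_norm_le (hexp x) (ae_of_all _ hgM)
      _ = M / c * Real.exp (c * x) := by
          rw [integral_const_mul, integral_exp_mul_Iic hc]; ring
  · rw [← L.integral_comp_comm (hint x)]
    simp [hL]

theorem exists_primitive_norm_le_exp {c M : ℝ} (hc : c ≠ 0) {g : ℝ → E}
    (hg : Continuous g) (hgM : ∀ x, ‖g x‖ ≤ M * Real.exp (c * x)) :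
    ∃ G : ℝ → E, (∀ x, HasDerivAt G (g x) x) ∧
      (∀ x, ‖G x‖ ≤ M / |c| * Real.exp (c * x)) ∧
      ∀ L : E →L[ℂ] E, (∀ x, L (g x) = 0) → ∀ x, L (G x) = 0 := by
  rcases hc.lt_or_gt with hc | hc
  · obtain ⟨G, hG, hGM, hGL⟩ := exists_primitive_norm_le_exp_of_pos (c := -c) (M := M)
      (neg_pos.2 hc) (hg.comp continuous_neg) (fun x => by simpa using hgM (-x))
    refine ⟨fun x => -G (-x), fun x => ?_, fun x => ?_, fun L hL x => ?_⟩
    · exact ((hG (-x)).scomp x (hasDerivAt_neg x)).neg.congr_deriv (by simp)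
    · simpa [abs_of_neg hc] using hGM (-x)
    · simpa using hGL L (fun x => hL (-x)) (-x)
  · simpa [abs_of_pos hc] using exists_primitive_norm_le_exp_of_pos hc hg hgM

theorem hasDerivAt_cexp_mul (z : ℂ) (x : ℝ) :
    HasDerivAt (fun y : ℝ => Complex.exp (z * y)) (z * Complex.exp (z * x)) x := by
  have h : HasDerivAt (fun y : ℝ => z * (y : ℂ)) z x := by
    simpa using (Complex.ofRealCLM.hasDerivAt (x := x)).const_mul z
  simpa [mul_comm] using h.cexp

/-- Bounded solvability of `u' = l u + f` in the space of functions of size `e^{η x}`, for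
`Re l ≠ η`. The solution is annihilated by every operator that annihilates `f`. -/
theorem exists_scalar_solution {l : ℂ} {η M : ℝ} (hl : l.re ≠ η) {f : ℝ → E}
    (hf : Continuous f) (hfM : ∀ x, ‖f x‖ ≤ M * Real.exp (η * x)) :
    ∃ u : ℝ → E, (∀ x, HasDerivAt u (l • u x + f x) x) ∧
      (∀ x, ‖u x‖ ≤ M / |η - l.re| * Real.exp (η * x)) ∧
      ∀ L : E →L[ℂ] E, (∀ x, L (f x) = 0) → ∀ x, L (u x) = 0 := by
  obtain ⟨G, hG, hGM, hGL⟩ := exists_primitive_norm_le_exp (c := η - l.re) (M := M)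
    (g := fun x : ℝ => Complex.exp (-l * x) • f x) (sub_ne_zero.2 hl.symm) (by fun_prop) (by
      intro x
      calc ‖Complex.exp (-l * x) • f x‖ = Real.exp (-l.re * x) * ‖f x‖ := by
            simp [norm_smul, Complex.norm_exp]
        _ ≤ Real.exp (-l.re * x) * (M * Real.exp (η * x)) := by gcongr; exact hfM x
        _ = M * Real.exp ((η - l.re) * x) := by
            rw [mul_left_comm, ← Real.exp_add]; ring_nf)
  refine ⟨fun x => Complex.exp (l * x) • G x, fun x => ?_, fun x => ?_, fun L hL x => ?_⟩
  · refine ((hasDerivAt_cexp_mul l x).smul (hG x)).congr_deriv ?_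
    rw [smul_smul, ← Complex.exp_add, smul_smul, add_comm]
    simp
  · calc ‖Complex.exp (l * x) • G x‖ = Real.exp (l.re * x) * ‖G x‖ := by
            simp [norm_smul, Complex.norm_exp]
      _ ≤ Real.exp (l.re * x) * (M / |η - l.re| * Real.exp ((η - l.re) * x)) := by
            gcongr; exact hGM x
      _ = M / |η - l.re| * Real.exp (η * x) := by
            rw [mul_left_comm, ← Real.exp_add]; ring_nf
  · simp [hGL L (fun x => by simp [hL])]

open Polynomial in
theorem exists_solution_of_aeval_prod_eq_zero (B : E →L[ℂ] E) (η : ℝ) (s : Multiset ℂ)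
    (hs : ∀ l ∈ s, l.re ≠ η) :
    ∃ K : ℝ, 0 ≤ K ∧ ∀ (M : ℝ) (f : ℝ → E), 0 ≤ M → Continuous f →
      (∀ x, ‖f x‖ ≤ M * Real.exp (η * x)) →
      (∀ x, aeval B (s.map fun l => X - C l).prod (f x) = 0) →
      ∃ y : ℝ → E, (∀ x, HasDerivAt y (B (y x) + f x) x) ∧
        ∀ x, ‖y x‖ ≤ K * M * Real.exp (η * x) := by
  induction s using Multiset.induction_on with
  | empty =>
    refine ⟨0, le_rfl, fun M f _ _ _ hf0 => ⟨0, fun x => ?_, fun x => by simp⟩⟩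
    have : f x = 0 := by simpa using hf0 x
    simp [this]
  | cons l s ih =>
    obtain ⟨K, hK, ih⟩ := ih fun a ha => hs a (Multiset.mem_cons_of_mem ha)
    have hl := hs l (Multiset.mem_cons_self l s)
    have hd : 0 < |η - l.re| := abs_pos.2 (sub_ne_zero.2 hl.symm)
    set T : E →L[ℂ] E := B - algebraMap ℂ (E →L[ℂ] E) l with hT
    have hTx (v : E) : T v = B v - l • v := by simp [hT, Algebra.algebraMap_eq_smul_one]
    refine ⟨1 / |η - l.re| + K * (‖T‖ / |η - l.re|), by positivity,
      fun M f hM hf hfM hf0 => ?_⟩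
    obtain ⟨u, hu, huM, huL⟩ := exists_scalar_solution hl hf hfM
    have huc : Continuous u := continuous_iff_continuousAt.2 fun x => (hu x).continuousAt
    obtain ⟨y, hy, hyM⟩ := ih (‖T‖ * (M / |η - l.re|)) (fun x => T (u x)) (by positivity)
      (by fun_prop)
      (fun x => (T.le_opNorm _).trans (by rw [mul_assoc]; gcongr; exact huM x))
      (fun x => by
        have := huL _ hf0 x
        rw [Multiset.map_cons, Multiset.prod_cons, mul_comm, map_mul] at this
        simpa [hT] using this)
    refine ⟨fun x => u x + y x, fun x => ?_, fun x => ?_⟩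
    · refine ((hu x).add (hy x)).congr_deriv ?_
      rw [hTx, map_add]; abel
    · refine (norm_add_le _ _).trans ((add_le_add (huM x) (hyM x)).trans (le_of_eq ?_))
      ring

end ExponentialWeights

/-- Bounded solvability of `y' = B y + f` in the space of functions of size `e^{η x}`, for all
but finitely many weights `η`. -/
theorem exists_finset_forall_notMem_exists_solution [FiniteDimensional ℂ E] (B : E →L[ℂ] E) :
    ∃ S : Finset ℝ, ∀ η ∉ S, ∃ K : ℝ, 0 ≤ K ∧ ∀ (M : ℝ) (f : ℝ → E), 0 ≤ M → Continuous f →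
      (∀ x, ‖f x‖ ≤ M * Real.exp (η * x)) →
      ∃ y : ℝ → E, (∀ x, HasDerivAt y (B (y x) + f x) x) ∧
        ∀ x, ‖y x‖ ≤ K * M * Real.exp (η * x) := by
  have := FiniteDimensional.complete ℂ E
  classical
  refine ⟨((minpoly ℂ B).roots.map Complex.re).toFinset, fun η hη => ?_⟩
  obtain ⟨K, hK, h⟩ := exists_solution_of_aeval_prod_eq_zero B η (minpoly ℂ B).roots
    fun l hl h => hη (by rw [Multiset.mem_toFinset, ← h]; exact Multiset.mem_map_of_mem _ hl)
  refine ⟨K, hK, fun M f hM hf hfM => h M f hM hf hfM fun x => ?_⟩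
  rw [← (IsAlgClosed.splits _).eq_prod_roots_of_monic
    (minpoly.monic (Algebra.IsIntegral.isIntegral B)), minpoly.aeval]
  simp

/-- Successive approximation: if `y' = B y + P z` is solvable with a gain `q < 1` in a weighted
space, then `Z' = B Z + P Z + f` is solvable as soon as `Z' = B Z + f` is. -/
theorem exists_solution_of_successive_approximation [CompleteSpace E] {B P : ℝ → E →L[ℂ] E}
    (hB : Continuous B) (hP : Continuous P) {w : ℝ → ℝ} (hw : Monotone w)
    {q : ℝ} (hq0 : 0 ≤ q) (hq : q < 1)
    (step : ∀ (M : ℝ) (z : ℝ → E), 0 ≤ M → Continuous z → (∀ x, ‖z x‖ ≤ M * w x) →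
      ∃ y : ℝ → E, (∀ x, HasDerivAt y (B x (y x) + P x (z x)) x) ∧
        ∀ x, ‖y x‖ ≤ q * M * w x)
    {f z₀ : ℝ → E} {M : ℝ} (hM : 0 ≤ M) (hz₀ : ∀ x, HasDerivAt z₀ (B x (z₀ x) + f x) x)
    (hz₀M : ∀ x, ‖z₀ x‖ ≤ M * w x) :
    ∃ Z : ℝ → E, (∀ x, HasDerivAt Z (B x (Z x) + P x (Z x) + f x) x) ∧
      ∀ x, ‖Z x‖ ≤ M / (1 - q) * w x := by
  choose! T hT hTM using step
  let z : ℕ → ℝ → E := fun n => Nat.rec z₀ (fun n y => T (q ^ n * M) y) n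
  have hz (n : ℕ) : Continuous (z n) ∧ ∀ x, ‖z n x‖ ≤ q ^ n * M * w x := by
    induction n with
    | zero =>
      exact ⟨continuous_iff_continuousAt.2 fun x => (hz₀ x).continuousAt,
        fun x => by simpa [z] using hz₀M x⟩
    | succ n ih =>
      refine ⟨continuous_iff_continuousAt.2 fun x =>
        (hT _ _ (by positivity) ih.1 ih.2 x).continuousAt, fun x => ?_⟩
      rw [pow_succ', mul_assoc q]
      exact hTM _ _ (by positivity) ih.1 ih.2 x
  have hz' (n : ℕ) (x : ℝ) : HasDerivAt (z (n + 1)) (B x (z (n + 1) x) + P x (z n x)) x :=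
    hT _ _ (by positivity) (hz n).1 (hz n).2 x
  have hgeom (x : ℝ) : HasSum (fun n => q ^ n * M * w x) (M / (1 - q) * w x) := by
    simpa [div_eq_inv_mul, mul_assoc] using
      (hasSum_geometric_of_lt_one hq0 hq).mul_right (M * w x)
  have hsum (x : ℝ) : Summable fun n => z n x :=
    .of_norm_bounded (hgeom x).summable fun n => (hz n).2 x
  refine ⟨fun x => ∑' n, z n x, fun x => ?_,
    fun x => tsum_of_norm_bounded (hgeom x) fun n => (hz n).2 x⟩
  have hsplit : (fun x => ∑' n, z n x) = fun x => z₀ x + ∑' n, z (n + 1) x :=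
    funext fun x => (hsum x).tsum_eq_zero_add
  obtain ⟨b, hb⟩ := (isCompact_Icc (a := x - 1) (b := x + 1)).exists_bound_of_continuousOn
    hB.continuousOn
  obtain ⟨p, hp⟩ := (isCompact_Icc (a := x - 1) (b := x + 1)).exists_bound_of_continuousOn
    hP.continuousOn
  have hxm : x ∈ Icc (x - 1) (x + 1) := by constructor <;> linarith
  have hb0 : 0 ≤ b := (norm_nonneg _).trans (hb x hxm)
  have hp0 : 0 ≤ p := (norm_nonneg _).trans (hp x hxm)
  have hder : HasDerivAt (fun y => ∑' n, z (n + 1) y)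
      (∑' n, (B x (z (n + 1) x) + P x (z n x))) x := by
    refine hasDerivAt_tsum_of_isPreconnected (t := Ioo (x - 1) (x + 1)) (y₀ := x)
      (g' := fun n y => B y (z (n + 1) y) + P y (z n y))
      (((hgeom (x + 1)).summable).mul_left (b * q + p)) isOpen_Ioo isPreconnected_Ioo
      (fun n y _ => hz' n y) (fun n y hy => ?_) (by simp)
      ((summable_nat_add_iff 1).2 (hsum x)) (by simp)
    have hy' := Ioo_subset_Icc_self hy
    have hwy : w y ≤ w (x + 1) := hw hy'.2
    calc ‖B y (z (n + 1) y) + P y (z n y)‖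
        ≤ b * (q ^ (n + 1) * M * w (x + 1)) + p * (q ^ n * M * w (x + 1)) := by
          refine (norm_add_le _ _).trans (add_le_add ?_ ?_)
          · refine (B y).le_of_opNorm_le_of_le (hb y hy') (((hz (n + 1)).2 y).trans ?_)
            gcongr
          · refine (P y).le_of_opNorm_le_of_le (hp y hy') (((hz n).2 y).trans ?_)
            gcongr
      _ = (b * q + p) * (q ^ n * M * w (x + 1)) := by ring
  rw [hsplit]
  refine ((hz₀ x).add hder).congr_deriv ?_
  have h1 : Summable fun n => z (n + 1) x := (summable_nat_add_iff 1).2 (hsum x)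
  have hPsum : P x (∑' n, z n x) = P x (z₀ x + ∑' n, z (n + 1) x) :=
    congrArg (P x) (hsum x).tsum_eq_zero_add
  rw [((B x).summable h1).tsum_add ((P x).summable (hsum x)), ← (B x).map_tsum h1,
    ← (P x).map_tsum (hsum x), hPsum]
  simp only [map_add]
  abel

/-- A linear equation with continuous coefficients on the line whose source vanishes on
`(-∞, x₀]` has a global solution vanishing there. -/
theorem exists_solution_eq_zero_on_Iic [CompleteSpace E] {A : ℝ → E →L[ℂ] E} (hA : Continuous A)
    {f : ℝ → E} (hf : Continuous f) {x₀ : ℝ} (hf0 : ∀ x ≤ x₀, f x = 0) :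
    ∃ Y : ℝ → E, (∀ x, HasDerivAt Y (A x (Y x) + f x) x) ∧ ∀ x ≤ x₀, Y x = 0 := by
  let a : ℝ → ℝ := fun x => 2 * (‖A x‖ + ‖f x‖)
  have ha : Continuous a := by fun_prop
  have ha0 (x : ℝ) : 0 ≤ a x := by positivity
  let Φ : ℝ → ℝ := fun x => ∫ t in x₀..x, a t
  have hΦ (x : ℝ) : HasDerivAt Φ (a x) x := (ha.integral_hasStrictDerivAt x₀ x).hasDerivAt
  have hΦmono : Monotone Φ := monotone_of_hasDerivAt_nonneg hΦ ha0
  have hΦc : Continuous Φ := continuous_iff_continuousAt.2 fun x => (hΦ x).continuousAt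
  have hΦ0 : Φ x₀ = 0 := intervalIntegral.integral_same
  let w : ℝ → ℝ := fun x => if x ≤ x₀ then 0 else Real.exp (Φ x)
  have hw0 (x : ℝ) : 0 ≤ w x := by
    dsimp only [w]; split_ifs <;> positivity
  have hw : Monotone w := by
    intro x y hxy
    by_cases hx : x ≤ x₀
    · simpa [w, hx] using hw0 y
    · have hy : ¬ y ≤ x₀ := fun h => hx (hxy.trans h)
      simpa [w, hx, hy] using hΦmono hxy
  have key (c : ℝ) (hc : 0 ≤ c) (g : ℝ → E) (hg : Continuous g) (hg0 : ∀ x ≤ x₀, g x = 0)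
      (hgc : ∀ x, x₀ ≤ x → ‖g x‖ ≤ c * (a x * Real.exp (Φ x))) :
      ∃ y : ℝ → E, (∀ x, HasDerivAt y (g x) x) ∧ ∀ x, ‖y x‖ ≤ c * w x := by
    refine ⟨fun x => ∫ t in x₀..x, g t,
      fun x => (hg.integral_hasStrictDerivAt x₀ x).hasDerivAt, fun x => ?_⟩
    rcases le_or_gt x x₀ with hx | hx
    · have : ∫ t in x₀..x, g t = ∫ t in x₀..x, (0 : E) :=
        intervalIntegral.integral_congr fun t ht => hg0 t (by
          rw [uIcc_of_ge hx] at ht; exact ht.2)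
      simp [this, w, hx]
    · have hcont : Continuous fun t => Real.exp (Φ t) * a t := by fun_prop
      have hFTC : ∫ t in x₀..x, c * (a t * Real.exp (Φ t)) = c * (Real.exp (Φ x) - 1) := by
        rw [intervalIntegral.integral_const_mul]
        simp_rw [mul_comm (a _)]
        rw [intervalIntegral.integral_eq_sub_of_hasDerivAt (fun t _ => (hΦ t).exp)
          (hcont.intervalIntegrable _ _), hΦ0, Real.exp_zero]
      calc ‖∫ t in x₀..x, g t‖ ≤ ∫ t in x₀..x, c * (a t * Real.exp (Φ t)) :=
            intervalIntegral.norm_integral_le_of_norm_le hx.le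
              (ae_of_all _ fun t ht => hgc t ht.1.le)
              (Continuous.intervalIntegrable (by fun_prop) _ _)
        _ = c * (Real.exp (Φ x) - 1) := hFTC
        _ ≤ c * w x := by
            simp only [w, hx.not_ge, if_false]
            gcongr; linarith
  have hvanish (M : ℝ) (z : ℝ → E) (hz : ∀ x, ‖z x‖ ≤ M * w x) (x : ℝ) (hx : x ≤ x₀) :
      z x = 0 := by
    simpa [w, hx] using hz x
  have hexp (x : ℝ) (hx : x₀ ≤ x) : 1 ≤ Real.exp (Φ x) :=
    Real.one_le_exp (hΦ0 ▸ hΦmono hx)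
  obtain ⟨y₀, hy₀, hy₀w⟩ := key 1 zero_le_one f hf hf0 fun x hx => by
    have h1 : ‖f x‖ ≤ a x := by
      have := norm_nonneg (A x); have := norm_nonneg (f x); dsimp only [a]; linarith
    calc ‖f x‖ ≤ a x * 1 := by rwa [mul_one]
      _ ≤ a x * Real.exp (Φ x) := mul_le_mul_of_nonneg_left (hexp x hx) (ha0 x)
      _ = 1 * (a x * Real.exp (Φ x)) := (one_mul _).symm
  obtain ⟨Y, hY, hYw⟩ := exists_solution_of_successive_approximation (B := 0) (P := A)
    continuous_const hA hw (q := 1 / 2) (by norm_num) (by norm_num)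
    (fun M z hM hz hzM => by
      obtain ⟨y, hy, hyw⟩ := key (1 / 2 * M) (by positivity) (fun x => A x (z x))
        (by fun_prop) (fun x hx => by simp [hvanish M z hzM x hx]) fun x hx => by
          have hwx : w x ≤ Real.exp (Φ x) := by
            dsimp only [w]; split_ifs
            · positivity
            · rfl
          have hAa : ‖A x‖ ≤ a x / 2 := by
            have := norm_nonneg (f x); dsimp only [a]; linarith
          calc ‖A x (z x)‖ ≤ a x / 2 * (M * Real.exp (Φ x)) :=
                (A x).le_of_opNorm_le_of_le hAa ((hzM x).trans (by gcongr))
            _ = 1 / 2 * M * (a x * Real.exp (Φ x)) := by ring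
      exact ⟨y, by simpa using hy, hyw⟩)
    zero_le_one (f := f) (z₀ := y₀) (by simpa using hy₀) hy₀w
  exact ⟨Y, by simpa using hY, hvanish _ Y hYw⟩

/-- A solution, defined on the whole line, of the gap lemma's equation for the profile `V`, with
the estimate near `-∞` only. -/
theorem exists_profile_near_neg_infty [FiniteDimensional ℂ E] {B : E →L[ℂ] E}
    {P : ℝ → E →L[ℂ] E} (hP : Continuous P) {C₁ θ θb : ℝ} (hC₁ : 0 < C₁)
    (hPθ : ∀ x ≤ 0, ‖P x‖ ≤ C₁ * Real.exp (θ * x)) (hθb : 0 < θb) (hθbθ : θb < θ)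
    {v : E} (hv : B v = 0) :
    ∃ (V : ℝ → E) (K m : ℝ), 0 ≤ K ∧ 0 ≤ m ∧
      (∀ x, HasDerivAt V (B (V x) + P x (V x)) x) ∧
      ∀ x ≤ -m, ‖V x - v‖ ≤ K * Real.exp (θb * x) * ‖v‖ := by
  have := FiniteDimensional.complete ℂ E
  have hθ : 0 < θ := hθb.trans hθbθ
  obtain ⟨S, hS⟩ := exists_finset_forall_notMem_exists_solution B
  obtain ⟨η, ⟨hη1, hη2⟩, hηS⟩ := (Ioo_infinite hθbθ).exists_notMem_finset S
  obtain ⟨K, hK, hsolve⟩ := hS η hηS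
  obtain ⟨m, hm0, hm⟩ : ∃ m : ℝ, 0 ≤ m ∧ K * (C₁ * Real.exp (θ * -m)) ≤ 1 / 2 := by
    have hlim : Tendsto (fun m : ℝ => K * (C₁ * Real.exp (θ * -m))) atTop (𝓝 0) := by
      have h : Tendsto (fun m : ℝ => θ * -m) atTop atBot :=
        tendsto_neg_atTop_atBot.const_mul_atBot hθ
      simpa using ((Real.tendsto_exp_atBot.comp h).const_mul C₁).const_mul K
    exact ((eventually_ge_atTop 0).and (hlim.eventually_le_const (by norm_num))).exists
  let Q : ℝ → E →L[ℂ] E := fun x => P (min x (-m))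
  have hQ : Continuous Q := by fun_prop
  have hmin (x : ℝ) : min x (-m) ≤ 0 := (min_le_right _ _).trans (by linarith)
  have hQsmall (x : ℝ) : ‖Q x‖ ≤ C₁ * Real.exp (θ * -m) := by
    refine (hPθ _ (hmin x)).trans ?_
    gcongr
    exact min_le_right _ _
  have hQη (x : ℝ) : ‖Q x‖ ≤ C₁ * Real.exp (η * x) := by
    refine (hPθ _ (hmin x)).trans ?_
    have h1 : θ * min x (-m) ≤ η * min x (-m) := mul_le_mul_of_nonpos_right hη2.le (hmin x)
    have h2 : η * min x (-m) ≤ η * x :=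
      mul_le_mul_of_nonneg_left (min_le_left _ _) (hθb.trans hη1).le
    exact mul_le_mul_of_nonneg_left (Real.exp_le_exp.2 (h1.trans h2)) hC₁.le
  obtain ⟨z₀, hz₀, hz₀M⟩ := hsolve (C₁ * ‖v‖) (fun x => Q x v) (by positivity) (by fun_prop)
    fun x => ((Q x).le_of_opNorm_le (hQη x) v).trans (le_of_eq (by ring))
  obtain ⟨Z, hZ, hZM⟩ := exists_solution_of_successive_approximation (B := fun _ => B) (P := Q)
    continuous_const hQ (w := fun x => Real.exp (η * x))
    (fun x y hxy => by
      have := mul_le_mul_of_nonneg_left hxy (hθb.trans hη1).le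
      simpa using this)
    (q := 1 / 2) (by norm_num) (by norm_num)
    (fun M z hM hz hzM => by
      obtain ⟨y, hy, hyM⟩ := hsolve (C₁ * Real.exp (θ * -m) * M) (fun x => Q x (z x))
        (by positivity) (by fun_prop)
        fun x => ((Q x).le_of_opNorm_le_of_le (hQsmall x) (hzM x)).trans (le_of_eq (by ring))
      refine ⟨y, hy, fun x => (hyM x).trans ?_⟩
      rw [← mul_assoc K]
      gcongr)
    (M := K * (C₁ * ‖v‖)) (by positivity) hz₀ hz₀M
  have hZc : Continuous Z := continuous_iff_continuousAt.2 fun x => (hZ x).continuousAt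
  obtain ⟨Y, hY, hY0⟩ := exists_solution_eq_zero_on_Iic (A := fun x => B + P x)
    (f := fun x => (P x - Q x) (v + Z x)) (x₀ := -m) (by fun_prop) (by fun_prop)
    fun x hx => by simp [Q, min_eq_left hx]
  refine ⟨fun x => v + Z x + Y x, K * C₁ / (1 - 1 / 2), m, by norm_num; positivity, hm0,
    fun x => ?_, fun x hx => ?_⟩
  · refine (((hZ x).const_add v).add (hY x)).congr_deriv ?_
    simp only [map_add, hv, add_apply, sub_apply]
    abel
  · have hx0 : x ≤ 0 := hx.trans (by linarith)
    have hexp : Real.exp (η * x) ≤ Real.exp (θb * x) :=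
      Real.exp_le_exp.2 (mul_le_mul_of_nonpos_right hη1.le hx0)
    calc ‖v + Z x + Y x - v‖ = ‖Z x‖ := by simp [hY0 x hx]
      _ ≤ K * (C₁ * ‖v‖) / (1 - 1 / 2) * Real.exp (η * x) := hZM x
      _ ≤ K * (C₁ * ‖v‖) / (1 - 1 / 2) * Real.exp (θb * x) := by
          gcongr
      _ = K * C₁ / (1 - 1 / 2) * Real.exp (θb * x) * ‖v‖ := by ring

theorem exists_profile [FiniteDimensional ℂ E] {B : E →L[ℂ] E}
    {P : ℝ → E →L[ℂ] E} (hP : Continuous P) {C₁ θ θb : ℝ} (hC₁ : 0 < C₁)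
    (hPθ : ∀ x ≤ 0, ‖P x‖ ≤ C₁ * Real.exp (θ * x)) (hθb : 0 < θb) (hθbθ : θb < θ)
    {v : E} (hv : B v = 0) :
    ∃ (C : ℝ) (V : ℝ → E), 0 < C ∧ (∀ x, HasDerivAt V (B (V x) + P x (V x)) x) ∧
      ∀ x ≤ 0, ‖V x - v‖ ≤ C * Real.exp (θb * x) * ‖v‖ := by
  rcases eq_or_ne v 0 with rfl | hv0
  · exact ⟨1, 0, one_pos, fun x => by simp, by simp⟩
  obtain ⟨V, K, m, hK, hm, hV, hVK⟩ :=
    exists_profile_near_neg_infty hP hC₁ hPθ hθb hθbθ hv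
  have hVc : Continuous V := continuous_iff_continuousAt.2 fun x => (hV x).continuousAt
  obtain ⟨D, hD⟩ := (isCompact_Icc (a := -m) (b := 0)).exists_bound_of_continuousOn
    (f := fun x => V x - v) (by fun_prop)
  have hD0 : 0 ≤ D := (norm_nonneg _).trans (hD 0 (by simpa using hm))
  have hvpos : 0 < ‖v‖ := norm_pos_iff.2 hv0
  refine ⟨K + D * Real.exp (θb * m) / ‖v‖ + 1, V, by positivity, hV, fun x hx => ?_⟩
  rcases le_or_gt x (-m) with hxm | hxm
  · refine (hVK x hxm).trans ?_
    gcongr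
    have : 0 ≤ D * Real.exp (θb * m) / ‖v‖ := by positivity
    linarith
  · have h1 : 1 ≤ Real.exp (θb * m) * Real.exp (θb * x) := by
      rw [← Real.exp_add, ← mul_add]
      exact Real.one_le_exp (mul_nonneg hθb.le (by linarith))
    calc ‖V x - v‖ ≤ D * 1 := by simpa using hD x ⟨hxm.le, hx⟩
      _ ≤ D * (Real.exp (θb * m) * Real.exp (θb * x)) := by gcongr
      _ = D * Real.exp (θb * m) / ‖v‖ * Real.exp (θb * x) * ‖v‖ := by field_simp
      _ ≤ (K + D * Real.exp (θb * m) / ‖v‖ + 1) * Real.exp (θb * x) * ‖v‖ := by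
          gcongr; linarith

end GapLemma


/-- The gap lemma (fixed spectral parameter): if the coefficient `A(x)` of the
linear system `W' = A(x) W` converges at exponential rate `e^{θ x}` to `Am` as
`x → -∞`, then any eigenpair `(μ, Vm)` of `Am` yields a solution
`W(x) = e^{μ x} V(x)` with `V(x) → Vm` at any slower exponential rate `θb < θ`. -/
theorem stmt_7 (N : ℕ)
    (A : ℝ → (EuclideanSpace ℂ (Fin N) →L[ℂ] EuclideanSpace ℂ (Fin N)))
    (hcont : Continuous A)
    (Am : EuclideanSpace ℂ (Fin N) →L[ℂ] EuclideanSpace ℂ (Fin N))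
    (C₁ θ : ℝ) (hC₁ : 0 < C₁) (hθ : 0 < θ)
    (hconv : ∀ x : ℝ, x ≤ 0 → ‖A x - Am‖ ≤ C₁ * Real.exp (θ * x))
    (μ : ℂ) (Vm : EuclideanSpace ℂ (Fin N)) (hev : Am Vm = μ • Vm)
    (θb : ℝ) (hθb : 0 < θb) (hθbθ : θb < θ) :
    ∃ (C : ℝ) (V : ℝ → EuclideanSpace ℂ (Fin N)), 0 < C ∧ ContDiff ℝ 1 V ∧
      (∀ x : ℝ, HasDerivAt (fun y : ℝ => Complex.exp (μ * (y : ℂ)) • V y)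
        (A x (Complex.exp (μ * (x : ℂ)) • V x)) x) ∧
      ∀ x : ℝ, x ≤ 0 → ‖V x - Vm‖ ≤ C * Real.exp (θb * x) * ‖Vm‖ := by
  have hB : (Am - μ • ContinuousLinearMap.id ℂ (EuclideanSpace ℂ (Fin N))) Vm = 0 := by simp [hev]
  obtain ⟨C, V, hC, hV, hVC⟩ := exists_profile (hcont.sub continuous_const) hC₁ hconv hθb hθbθ hB
  have hV' (x : ℝ) : HasDerivAt V (A x (V x) - μ • V x) x :=
    (hV x).congr_deriv (by simp)
  have hVc : Continuous V := continuous_iff_continuousAt.2 fun x => (hV' x).continuousAt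
  refine ⟨C, V, hC, contDiff_one_iff_deriv.2 ⟨fun x => (hV' x).differentiableAt, ?_⟩,
    fun x => ?_, hVC⟩
  · rw [funext fun x => (hV' x).deriv]
    fun_prop
  · refine ((hasDerivAt_cexp_mul μ x).smul (hV' x)).congr_deriv ?_
    rw [map_smul, smul_sub, smul_smul, mul_comm μ (Complex.exp _), sub_add_cancel]
end

section
/- Let 𝔸 : ℝ → M_N(ℂ) be continuous and let 𝔸₋ ∈ M_N(ℂ), C₁ > 0, θ > 0 satisfy ‖𝔸(x) − 𝔸₋‖ ≤ C₁ e^{θx} for all x ≤ 0. Then for every θ̄ ∈ (0, θ) there exist C > 0 and a continuously differentiable map P : (−∞, 0] → M_N(ℂ) such that: P′(x) = 𝔸(x)P(x) − P(x)𝔸₋ for all x ≤ 0 (equivalently, for every solution Z of the limiting constant-coefficient equation Z′ = 𝔸₋Z, the function W := PZ solves W′ = 𝔸(x)W on (−∞, 0]); P(x) is invertible for every x ≤ 0; and ‖P(x) − I‖ ≤ C e^{θ̄x} for all x ≤ 0. -/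
open Real Set Filter Topology MeasureTheory

lemma nonneg_of_norm_le_mul_exp {V : Type*} [SeminormedAddGroup V] {f : ℝ → V} {m κ : ℝ}
    (h : ∀ x, ‖f x‖ ≤ m * exp (κ * x)) : 0 ≤ m := by
  simpa using (norm_nonneg _).trans (h 0)

/-- For every continuous `f = O(e^{κ x})` on `ℝ`, the equation `u' = L u + f` has a solution
`u = O(e^{κ x})`, with operator bound `c`. -/
def ExpSolvable {V : Type*} [NormedAddCommGroup V] [NormedSpace ℂ V]
    (L : V →L[ℂ] V) (κ c : ℝ) : Prop :=
  ∀ (f : ℝ → V) (m : ℝ), Continuous f → (∀ x, ‖f x‖ ≤ m * exp (κ * x)) →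
    ∃ u : ℝ → V, (∀ x, HasDerivAt u (L (u x) + f x) x) ∧ ∀ x, ‖u x‖ ≤ c * m * exp (κ * x)

section ExpSolvable

variable {V : Type*} [NormedAddCommGroup V] [NormedSpace ℂ V]

lemma ExpSolvable.neg {L : V →L[ℂ] V} {κ c : ℝ} (h : ExpSolvable L κ c) :
    ExpSolvable (-L) (-κ) c := by
  intro f m hf hm
  obtain ⟨u, hu, hub⟩ := h (fun x => f (-x)) m (by fun_prop) (fun x => by simpa using hm (-x))
  refine ⟨fun x => -u (-x), fun x => ?_, fun x => by simpa using hub (-x)⟩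
  have := ((hu (-x)).scomp x (hasDerivAt_neg x)).neg
  convert! this using 1
  simp [add_comm]

variable [CompleteSpace V]

lemma hasDerivAt_integral_Iic {g : ℝ → V} (hg : Continuous g)
    (hint : ∀ x, IntegrableOn g (Iic x)) (x : ℝ) :
    HasDerivAt (fun y => ∫ s in Iic y, g s) (g x) x := by
  have heq : (fun y => ∫ s in Iic y, g s) = fun y => (∫ s in Iic x, g s) + ∫ s in x..y, g s := by
    funext y
    rw [← intervalIntegral.integral_Iic_sub_Iic (hint x) (hint y)]
    abel
  rw [heq]
  exact (intervalIntegral.integral_hasDerivAt_right (hg.intervalIntegrable _ _)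
    (hg.stronglyMeasurableAtFilter _ _) hg.continuousAt).const_add _

lemma expSolvable_smul_one_of_re_lt {lam : ℂ} {κ : ℝ} (h : lam.re < κ) :
    ExpSolvable (lam • (1 : V →L[ℂ] V)) κ (κ - lam.re)⁻¹ := by
  intro f m hf hm
  have hμ : 0 < κ - lam.re := sub_pos.2 h
  set g : ℝ → V := fun s => Complex.exp (-lam * s) • f s with hg
  have hgc : Continuous g := by fun_prop
  have hgb (s : ℝ) : ‖g s‖ ≤ m * exp ((κ - lam.re) * s) := by
    have : exp ((κ - lam.re) * s) = exp (-lam.re * s) * exp (κ * s) := by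
      rw [← exp_add]; ring_nf
    rw [hg, norm_smul, Complex.norm_exp, this]
    calc _ ≤ exp (-lam.re * s) * (m * exp (κ * s)) := by
          gcongr
          · simp
          · exact hm s
      _ = _ := by ring
  have hmaj (x : ℝ) : IntegrableOn (fun s => m * exp ((κ - lam.re) * s)) (Iic x) :=
    (integrableOn_exp_mul_Iic hμ x).const_mul m
  have hint (x : ℝ) : IntegrableOn g (Iic x) :=
    (hmaj x).mono' hgc.aestronglyMeasurable (ae_of_all _ hgb)
  refine ⟨fun x => Complex.exp (lam * x) • ∫ s in Iic x, g s, fun x => ?_, fun x => ?_⟩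
  · have hexp : HasDerivAt (fun y : ℝ => Complex.exp (lam * y)) (Complex.exp (lam * x) * lam) x := by
      have := ((Complex.ofRealCLM.hasDerivAt (x := x)).const_mul lam).cexp
      simpa using this
    have := hexp.smul (hasDerivAt_integral_Iic hgc hint x)
    convert! this using 1
    have hone : Complex.exp (lam * x) * Complex.exp (-lam * x) = 1 := by
      rw [← Complex.exp_add]; simp
    simp only [hg, smul_smul, hone, one_smul, smul_apply,
      one_apply_eq_self]
    rw [add_comm, mul_comm lam]
  · have hI : ‖∫ s in Iic x, g s‖ ≤ m * (exp ((κ - lam.re) * x) / (κ - lam.re)) := by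
      rw [← integral_exp_mul_Iic hμ, ← integral_const_mul]
      exact norm_integral_le_of_norm_le (hmaj x) (ae_of_all _ hgb)
    have hexp : exp (κ * x) = exp (lam.re * x) * exp ((κ - lam.re) * x) := by
      rw [← exp_add]; ring_nf
    rw [norm_smul, Complex.norm_exp, hexp]
    calc _ ≤ exp (lam.re * x) * (m * (exp ((κ - lam.re) * x) / (κ - lam.re))) := by
          gcongr
          simp
      _ = _ := by field_simp

lemma exists_expSolvable_smul_one {lam : ℂ} {κ : ℝ} (h : lam.re ≠ κ) :
    ∃ c, 0 ≤ c ∧ ExpSolvable (lam • (1 : V →L[ℂ] V)) κ c := by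
  rcases h.lt_or_gt with h | h
  · exact ⟨_, inv_nonneg.2 (sub_pos.2 h).le, expSolvable_smul_one_of_re_lt h⟩
  · have hre : (-lam).re < -κ := by simpa using h
    refine ⟨_, inv_nonneg.2 (sub_pos.2 hre).le, ?_⟩
    simpa using (expSolvable_smul_one_of_re_lt (V := V) hre).neg

/-- Newton-form solution of `u' = L u + f`, up to the remainder `∏ (L - λᵢ) w`. -/
lemma exists_newton_solution (L : V →L[ℂ] V) (κ : ℝ) (l : List ℂ) (hl : ∀ z ∈ l, z.re ≠ κ) :
    ∃ c, 0 ≤ c ∧ ∀ (f : ℝ → V) (m : ℝ), Continuous f → (∀ x, ‖f x‖ ≤ m * exp (κ * x)) →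
      ∃ u w : ℝ → V, Continuous w ∧
        (∀ x, HasDerivAt u
          (L (u x) + f x - Polynomial.aeval L (l.map fun z => Polynomial.X - Polynomial.C z).prod
            (w x)) x) ∧
        (∀ x, ‖u x‖ ≤ c * m * exp (κ * x)) ∧ ∀ x, ‖w x‖ ≤ c * m * exp (κ * x) := by
  induction l with
  | nil =>
    refine ⟨1, zero_le_one, fun f m hf hm => ⟨0, f, hf, fun x => ?_, fun x => ?_, fun x => ?_⟩⟩
    · simp
    · have := nonneg_of_norm_le_mul_exp hm
      simp only [Pi.zero_apply, norm_zero]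
      positivity
    · simpa using hm x
  | cons z l ih =>
    obtain ⟨c, hc, ih⟩ := ih fun y hy => hl y (List.mem_cons_of_mem _ hy)
    obtain ⟨d, hd, hz⟩ := exists_expSolvable_smul_one (V := V) (hl z List.mem_cons_self)
    set p := (l.map fun z => Polynomial.X - Polynomial.C z).prod
    set T : V →L[ℂ] V := Polynomial.aeval L p with hT
    refine ⟨c + ‖T‖ * d * c + d * c, by positivity, fun f m hf hm => ?_⟩
    have hm0 := nonneg_of_norm_le_mul_exp hm
    obtain ⟨u, w, hw, hu, hub, hwb⟩ := ih f m hf hm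
    obtain ⟨W, hW, hWb⟩ := hz w (c * m) hw hwb
    refine ⟨fun x => u x + T (W x), W, continuous_iff_continuousAt.2 fun x => (hW x).continuousAt,
      fun x => ?_, fun x => ?_, fun x => ?_⟩
    · have hTW : HasDerivAt (fun y => T (W y)) (T ((z • (1 : V →L[ℂ] V)) (W x) + w x)) x := by
        simpa [Function.comp_def] using
          ((T.restrictScalars ℝ).hasFDerivAt.comp_hasDerivAt x (hW x))
      have hfac : Polynomial.aeval L
          (((z :: l).map fun z => Polynomial.X - Polynomial.C z).prod) = (L - z • 1) * T := by
        simp [hT, p, Algebra.algebraMap_eq_smul_one]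
      have hcomm : L (T (W x)) = T (L (W x)) := by
        have : L * T = T * L := by
          have := congrArg (Polynomial.aeval L) (mul_comm Polynomial.X p)
          simpa [hT] using this
        simpa using congrArg (fun S : V →L[ℂ] V => S (W x)) this
      convert! (hu x).add hTW using 1
      rw [hfac]
      simp only [map_add, ContinuousLinearMap.mul_def,
        ContinuousLinearMap.comp_apply, sub_apply,
        smul_apply, one_apply_eq_self, map_smul]
      abel
    · calc ‖u x + T (W x)‖ ≤ ‖u x‖ + ‖T‖ * ‖W x‖ :=
            (norm_add_le _ _).trans (by gcongr; exact T.le_opNorm _)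
        _ ≤ c * m * exp (κ * x) + ‖T‖ * (d * (c * m) * exp (κ * x)) := by
            gcongr
            · exact hub x
            · exact hWb x
        _ ≤ c * m * exp (κ * x) + ‖T‖ * (d * (c * m) * exp (κ * x))
              + d * c * m * exp (κ * x) := le_add_of_nonneg_right (by positivity)
        _ = _ := by ring
    · calc ‖W x‖ ≤ d * (c * m) * exp (κ * x) := hWb x
        _ ≤ d * (c * m) * exp (κ * x) + (c + ‖T‖ * d * c) * m * exp (κ * x) :=
            le_add_of_nonneg_right (by positivity)
        _ = _ := by ring

lemma exists_expSolvable [FiniteDimensional ℂ V] (L : V →L[ℂ] V) :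
    ∃ S : Set ℝ, S.Finite ∧ ∀ κ ∉ S, ∃ c, 0 ≤ c ∧ ExpSolvable L κ c := by
  have hL : IsIntegral ℂ L := Algebra.IsIntegral.isIntegral L
  set p := minpoly ℂ L with hp
  refine ⟨Complex.re '' {z | z ∈ p.roots}, (Multiset.finite_toSet p.roots).image _,
    fun κ hκ => ?_⟩
  obtain ⟨c, hc, h⟩ := exists_newton_solution L κ p.roots.toList fun z hz hre =>
    hκ ⟨z, by simpa using hz, hre⟩
  have hprod : (p.roots.toList.map fun z => Polynomial.X - Polynomial.C z).prod = p := by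
    rw [← Multiset.prod_coe, ← Multiset.map_coe, Multiset.coe_toList]
    exact ((IsAlgClosed.splits p).eq_prod_roots_of_monic (minpoly.monic hL)).symm
  refine ⟨c, hc, fun f m hf hm => ?_⟩
  obtain ⟨u, w, -, hu, hub, -⟩ := h f m hf hm
  refine ⟨u, fun x => ?_, hub⟩
  have := hu x
  rw [hprod, minpoly.aeval] at this
  simpa using this

/-- Solvability with exponential weights survives perturbations that are small in operator norm. -/
lemma ExpSolvable.exists_perturbed_solution {L : V →L[ℂ] V} {κ c b : ℝ} (h : ExpSolvable L κ c)
    (hc : 0 ≤ c) {B : ℝ → V →L[ℂ] V} (hB : Continuous B) (hb : ∀ x, ‖B x‖ ≤ b) (hcb : c * b < 1)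
    {f : ℝ → V} {m : ℝ} (hf : Continuous f) (hm : ∀ x, ‖f x‖ ≤ m * exp (κ * x)) :
    ∃ u : ℝ → V, (∀ x, HasDerivAt u (L (u x) + B x (u x) + f x) x) ∧
      ∃ m', 0 ≤ m' ∧ ∀ x, ‖u x‖ ≤ m' * exp (κ * x) := by
  have hb0 : 0 ≤ b := (norm_nonneg _).trans (hb 0)
  have hm0 := nonneg_of_norm_le_mul_exp hm
  have hq0 : 0 ≤ c * b := mul_nonneg hc hb0
  have h' : ∀ (f : ℝ → V) (m : ℝ), ∃ u : ℝ → V, Continuous f → (∀ x, ‖f x‖ ≤ m * exp (κ * x)) →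
      (∀ x, HasDerivAt u (L (u x) + f x) x) ∧ ∀ x, ‖u x‖ ≤ c * m * exp (κ * x) := by
    intro f m
    by_cases hfm : Continuous f ∧ ∀ x, ‖f x‖ ≤ m * exp (κ * x)
    · obtain ⟨u, hu⟩ := h f m hfm.1 hfm.2
      exact ⟨u, fun _ _ => hu⟩
    · exact ⟨0, fun h₁ h₂ => absurd ⟨h₁, h₂⟩ hfm⟩
  choose S hS using h'
  let F : ℕ → ℝ → V := fun n =>
    Nat.rec f (fun n g x => B x (S g (m * (c * b) ^ n) x)) n
  let w : ℕ → ℝ → V := fun n => S (F n) (m * (c * b) ^ n)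
  have hFsucc (n : ℕ) (x : ℝ) : F (n + 1) x = B x (w n x) := rfl
  have hF (n : ℕ) : Continuous (F n) ∧ ∀ x, ‖F n x‖ ≤ m * (c * b) ^ n * exp (κ * x) := by
    induction n with
    | zero => exact ⟨hf, by simpa [F] using hm⟩
    | succ n ih =>
      obtain ⟨hd, hw⟩ := hS _ _ ih.1 ih.2
      have hwc : Continuous (w n) := continuous_iff_continuousAt.2 fun x => (hd x).continuousAt
      refine ⟨hB.clm_apply hwc, fun x => ?_⟩
      calc ‖B x (w n x)‖ ≤ b * (c * (m * (c * b) ^ n) * exp (κ * x)) :=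
            (B x).le_of_opNorm_le_of_le (hb x) (hw x)
        _ = _ := by ring
  have hw (n : ℕ) := (hS _ _ (hF n).1 (hF n).2).1
  have hwb (n : ℕ) (x : ℝ) : ‖w n x‖ ≤ c * m * exp (κ * x) * (c * b) ^ n :=
    ((hS _ _ (hF n).1 (hF n).2).2 x).trans_eq (by ring)
  have hgeo := hasSum_geometric_of_lt_one hq0 hcb
  have hwsum (x : ℝ) : Summable fun n => w n x :=
    .of_norm_bounded (hgeo.summable.mul_left _) fun n => hwb n x
  have hFsum (x : ℝ) : Summable fun n => F n x :=
    .of_norm_bounded (hgeo.summable.mul_left (m * exp (κ * x)))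
      fun n => ((hF n).2 x).trans_eq (by ring)
  refine ⟨fun x => ∑' n, w n x, fun x => ?_, c * m * (1 - c * b)⁻¹,
    mul_nonneg (by positivity) (inv_nonneg.2 (by linarith)), fun x => ?_⟩
  · obtain ⟨K, hK⟩ : ∃ K, ∀ y ∈ Metric.ball x 1, exp (κ * y) ≤ K := by
      obtain ⟨K, hK⟩ := (isCompact_closedBall x 1).bddAbove_image
        (f := fun y => exp (κ * y)) (by fun_prop)
      exact ⟨K, fun y hy => hK ⟨y, Metric.ball_subset_closedBall hy, rfl⟩⟩
    have hder := hasDerivAt_tsum_of_isPreconnected (𝕜 := ℝ)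
      (u := fun n => (‖L‖ * (c * m * K) + m * K) * (c * b) ^ n)
      (g := w) (g' := fun n y => L (w n y) + F n y) (y₀ := x) (y := x)
      (hgeo.summable.mul_left _) Metric.isOpen_ball (convex_ball x 1).isPreconnected
      (fun n y _ => hw n y) (fun n y hy => ?_) (Metric.mem_ball_self one_pos) (hwsum x)
      (Metric.mem_ball_self one_pos)
    · convert! hder using 1
      rw [((L.summable (hwsum x))).tsum_add (hFsum x), (hFsum x).tsum_eq_zero_add,
        L.map_tsum (hwsum x)]
      simp only [hFsucc]
      rw [(B x).map_tsum (hwsum x), show F 0 x = f x from rfl]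
      abel
    · calc ‖L (w n y) + F n y‖ ≤ ‖L‖ * ‖w n y‖ + ‖F n y‖ :=
            (norm_add_le _ _).trans (by gcongr; exact L.le_opNorm _)
        _ ≤ ‖L‖ * (c * m * K * (c * b) ^ n) + m * (c * b) ^ n * K := by
            gcongr
            · refine (hwb n y).trans ?_
              gcongr
              exact hK y hy
            · refine ((hF n).2 y).trans ?_
              gcongr
              exact hK y hy
        _ = _ := by ring
  · exact (tsum_of_norm_bounded (hgeo.mul_left _) fun n => hwb n x).trans_eq (by ring)

/-- A kernel vector of `L` is the limit at `-∞` of a solution of `v' = (L + B(min x 0)) v` if `B`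
decays exponentially. -/
lemma exists_solution_tendsto_kernel [FiniteDimensional ℂ V] (L : V →L[ℂ] V) {B : ℝ → V →L[ℂ] V}
    (hB : Continuous B) {C₁ θ κ₀ : ℝ} (hκ₀ : 0 < κ₀) (hκ₀θ : κ₀ < θ)
    (hBθ : ∀ x ≤ 0, ‖B x‖ ≤ C₁ * exp (θ * x)) {v₀ : V} (hv₀ : L v₀ = 0) :
    ∃ v : ℝ → V, (∀ x, HasDerivAt v (L (v x) + B (min x 0) (v x)) x) ∧
      ∃ C, 0 ≤ C ∧ ∀ x ≤ 0, ‖v x - v₀‖ ≤ C * exp (κ₀ * x) := by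
  have hC₁ : 0 ≤ C₁ := by simpa using (norm_nonneg _).trans (hBθ 0 le_rfl)
  have hθ : 0 < θ := hκ₀.trans hκ₀θ
  obtain ⟨S, hS, hLS⟩ := exists_expSolvable L
  obtain ⟨κ, ⟨hκ₀κ, hκθ⟩, hκS⟩ := ((Ioo_infinite hκ₀θ).sdiff hS).nonempty
  have hκ : 0 < κ := hκ₀.trans hκ₀κ
  obtain ⟨c, hc, hsolv⟩ := hLS κ hκS
  obtain ⟨M, hM, hsmall⟩ : ∃ M, 0 ≤ M ∧ c * (C₁ * exp (θ * -M)) < 1 := by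
    have hlim : Tendsto (fun M : ℝ => c * (C₁ * exp (θ * -M))) atTop (𝓝 (c * (C₁ * 0))) :=
      ((tendsto_exp_atBot.comp
        (tendsto_neg_atTop_atBot.const_mul_atBot hθ)).const_mul C₁).const_mul c
    obtain ⟨M, h₁, h₂⟩ :=
      ((hlim.eventually_lt_const (u := 1) (by simp)).and (eventually_ge_atTop 0)).exists
    exact ⟨M, h₂, h₁⟩
  have hBM (x : ℝ) : ‖B (min x (-M))‖ ≤ C₁ * exp (θ * min x (-M)) :=
    hBθ _ ((min_le_right _ _).trans (by linarith))
  have hB0 (x : ℝ) : ‖B (min x 0)‖ ≤ C₁ :=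
    (hBθ _ (min_le_right _ _)).trans (mul_le_of_le_one_right hC₁
      (exp_le_one_iff.2 (mul_nonpos_of_nonneg_of_nonpos hθ.le (min_le_right _ _))))
  have hBM' (x : ℝ) : ‖B (min x (-M))‖ ≤ C₁ := by
    simpa [min_assoc, hM] using hB0 (min x (-M))
  obtain ⟨u, hu, m₁, hm₁, hub⟩ := hsolv.exists_perturbed_solution hc
    (B := fun x => B (min x (-M))) (by fun_prop)
    (fun x => (hBM x).trans (by gcongr; exact min_le_right _ _)) hsmall
    (f := fun x => B (min x (-M)) v₀) (m := C₁ * ‖v₀‖) (by fun_prop) (fun x => by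
      calc ‖B (min x (-M)) v₀‖ ≤ C₁ * exp (κ * x) * ‖v₀‖ := by
            refine (B _).le_of_opNorm_le ((hBM x).trans ?_) v₀
            gcongr C₁ * exp ?_
            rcases le_total x (-M) with hx | hx
            · rw [min_eq_left hx]; nlinarith
            · rw [min_eq_right hx]; nlinarith
        _ = _ := by ring)
  have huc : Continuous u := continuous_iff_continuousAt.2 fun x => (hu x).continuousAt
  set R : ℝ := ‖L‖ + C₁ + κ + 1 with hR
  have hL0 := norm_nonneg L
  have hR0 : 0 < R := by positivity
  obtain ⟨r, hr, m₂, hm₂, hrb⟩ :=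
    (expSolvable_smul_one_of_re_lt (V := V) (lam := 0) (κ := R)
      (by simpa)).exists_perturbed_solution (by simpa using hR0.le)
    (B := fun x => L + B (min x 0)) (b := ‖L‖ + C₁) (by fun_prop)
    (fun x => (norm_add_le _ _).trans (by gcongr; exact hB0 x))
    (by
      rw [Complex.zero_re, sub_zero, inv_mul_lt_one₀ hR0]
      linarith)
    (f := fun x => (B (min x 0) - B (min x (-M))) (v₀ + u x))
    (m := (C₁ + C₁) * (‖v₀‖ + m₁) * exp (R * M)) (by fun_prop) (fun x => by
      rcases le_total x (-M) with hx | hx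
      · rw [min_eq_left hx, min_eq_left (hx.trans (by linarith)), sub_self]
        simp only [zero_apply, norm_zero]
        positivity
      · have h₁ : 1 ≤ exp (R * (x + M)) := one_le_exp (by nlinarith)
        have h₂ : exp (κ * x) ≤ exp (R * (x + M)) := by
          refine exp_le_exp.2 ?_
          have : 0 ≤ x + M := by linarith
          have : κ ≤ R := by linarith
          nlinarith
        calc _ ≤ (C₁ + C₁) * (‖v₀‖ * exp (R * (x + M)) + m₁ * exp (R * (x + M))) := by
              refine ContinuousLinearMap.le_of_opNorm_le_of_le _
                ((norm_sub_le _ _).trans (add_le_add (hB0 x) (hBM' x)))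
                ((norm_add_le _ _).trans (add_le_add ?_ ((hub x).trans ?_)))
              · exact le_mul_of_one_le_right (norm_nonneg _) h₁
              · gcongr
          _ = _ := by rw [mul_add R, exp_add]; ring)
  refine ⟨fun x => v₀ + u x + r x, fun x => ?_, m₁ + m₂, by positivity, fun x hx => ?_⟩
  · convert! ((hu x).const_add v₀).add (hr x) using 1
    simp only [map_add, hv₀, zero_smul, zero_apply,
      add_apply, sub_apply]
    abel
  · calc ‖v₀ + u x + r x - v₀‖ = ‖u x + r x‖ := by congr 1; abel
      _ ≤ m₁ * exp (κ * x) + m₂ * exp (R * x) :=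
          (norm_add_le _ _).trans (add_le_add (hub x) (hrb x))
      _ ≤ m₁ * exp (κ₀ * x) + m₂ * exp (κ₀ * x) := by
          gcongr ?_ * exp ?_ + ?_ * exp ?_ <;> nlinarith
      _ = _ := by ring

end ExpSolvable

section Conjugation

variable {𝔸 : Type*} [NormedRing 𝔸] [NormedAlgebra ℂ 𝔸] [CompleteSpace 𝔸]

/-- If `S' = Am S - S Am` on `ℝ` and `S` is invertible somewhere, it is invertible everywhere. -/
lemma isUnit_of_hasDerivAt_commutator {S : ℝ → 𝔸} {Am : 𝔸}
    (hS : ∀ x, HasDerivAt S (Am * S x - S x * Am) x) {x₀ : ℝ} (h₀ : IsUnit (S x₀)) (x : ℝ) :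
    IsUnit (S x) := by
  let _ : NormedAlgebra ℚ 𝔸 := NormedAlgebra.restrictScalars ℚ ℂ 𝔸
  let e : ℝ → 𝔸 := fun y => NormedSpace.exp (y • Am)
  have hu (y : ℝ) : IsUnit (e y) := NormedSpace.isUnit_exp _
  have hinv (y : ℝ) : e (-y) * e y = 1 ∧ e y * e (-y) = 1 := by
    have h₁ := NormedSpace.exp_add_of_commute (x := (-y) • Am) (y := y • Am)
      (((Commute.refl Am).smul_left _).smul_right _)
    have h₂ := NormedSpace.exp_add_of_commute (x := y • Am) (y := (-y) • Am)
      (((Commute.refl Am).smul_left _).smul_right _)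
    rw [← add_smul] at h₁ h₂
    simp only [neg_add_cancel, add_neg_cancel, zero_smul, NormedSpace.exp_zero] at h₁ h₂
    exact ⟨h₁.symm, h₂.symm⟩
  have he (y : ℝ) : HasDerivAt e (e y * Am) y := hasDerivAt_exp_smul_const Am y
  have he' (y : ℝ) : HasDerivAt e (Am * e y) y := hasDerivAt_exp_smul_const' Am y
  have hneg (y : ℝ) : HasDerivAt (fun z => e (-z)) (-(e (-y) * Am)) y := by
    simpa [Function.comp_def] using (he (-y)).scomp y (hasDerivAt_neg y)
  have hder (y : ℝ) : HasDerivAt (fun z => e (-z) * S z * e z) 0 y := by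
    convert! ((hneg y).mul (hS y)).mul (he' y) using 1
    simp only [Pi.mul_apply]
    noncomm_ring
  have hconst : e (-x) * S x * e x = e (-x₀) * S x₀ * e x₀ :=
    is_const_of_deriv_eq_zero (fun y => (hder y).differentiableAt) (fun y => (hder y).deriv) x x₀
  have hx : S x = e x * (e (-x₀) * S x₀ * e x₀) * e (-x) := by
    rw [← hconst, mul_assoc (e (-x)), ← mul_assoc, ← mul_assoc, (hinv x).2, one_mul, mul_assoc,
      (hinv x).2, mul_one]
  rw [hx]
  exact ((hu x).mul (((hu _).mul h₀).mul (hu _))).mul (hu _)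

/-- The conjugation lemma in a finite-dimensional normed algebra. -/
lemma exists_conjugator [FiniteDimensional ℂ 𝔸] {A : ℝ → 𝔸} (hA : Continuous A) {Am : 𝔸}
    {C₁ θ κ : ℝ} (hκ : 0 < κ) (hκθ : κ < θ)
    (hconv : ∀ x ≤ 0, ‖A x - Am‖ ≤ C₁ * exp (θ * x)) :
    ∃ (C : ℝ) (P : ℝ → 𝔸), 0 < C ∧ (∀ x ≤ 0, HasDerivAt P (A x * P x - P x * Am) x) ∧
      (∀ x ≤ 0, IsUnit (P x)) ∧ ∀ x ≤ 0, ‖P x - 1‖ ≤ C * exp (κ * x) := by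
  let l := ContinuousLinearMap.mul ℂ 𝔸
  have hker : (l Am - l.flip Am) 1 = 0 := by simp [l]
  obtain ⟨P, hP, C, hC, hPb⟩ := exists_solution_tendsto_kernel (l Am - l.flip Am)
    (B := fun x => l (A x - Am)) (by fun_prop) hκ hκθ
    (fun x hx => (ContinuousLinearMap.opNorm_mul_apply_le ℂ 𝔸 _).trans (hconv x hx)) hker
  obtain ⟨Q, hQ, D, hD, hQb⟩ := exists_solution_tendsto_kernel (l Am - l.flip Am)
    (B := fun x => -l.flip (A x - Am)) (by fun_prop) hκ hκθ
    (fun x hx => by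
      rw [norm_neg]
      refine le_trans (ContinuousLinearMap.opNorm_le_bound _ (norm_nonneg _) fun y => ?_)
        (hconv x hx)
      simpa [l, mul_comm, mul_sub] using norm_mul_le y (A x - Am)) hker
  have hP' (x : ℝ) : HasDerivAt P (A (min x 0) * P x - P x * Am) x := by
    convert! hP x using 1
    simp [l]
  have hQ' (x : ℝ) : HasDerivAt Q (Am * Q x - Q x * A (min x 0)) x := by
    convert! hQ x using 1
    simp [l]
  have hlim : ∀ {R : ℝ → 𝔸} {K : ℝ}, (∀ x ≤ 0, ‖R x - 1‖ ≤ K * exp (κ * x)) →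
      Tendsto R atBot (𝓝 1) := by
    intro R K hR
    rw [tendsto_iff_norm_sub_tendsto_zero]
    refine squeeze_zero' (Eventually.of_forall fun _ => norm_nonneg _)
      ((eventually_le_atBot 0).mono hR) ?_
    simpa using (tendsto_exp_atBot.comp (tendsto_id.const_mul_atBot hκ)).const_mul K
  have hunits : ∀ᶠ y in 𝓝 (1 : 𝔸), IsUnit y := Units.isOpen.mem_nhds isUnit_one
  have hQP : Tendsto (fun x => Q x * P x) atBot (𝓝 1) := by
    simpa using (hlim hQb).mul (hlim hPb)
  obtain ⟨x₀, hx₀⟩ := (hQP.eventually hunits).exists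
  have hQPunit (x : ℝ) : IsUnit (Q x * P x) :=
    isUnit_of_hasDerivAt_commutator (S := fun x => Q x * P x) (Am := Am)
      (fun y => by
        convert! (hQ' y).mul (hP' y) using 1
        noncomm_ring) hx₀ x
  have : IsArtinianRing 𝔸 := IsArtinianRing.of_finite ℂ 𝔸
  refine ⟨C + 1, P, by positivity, fun x hx => ?_, fun x _ => ?_, fun x hx => ?_⟩
  · simpa [hx] using hP' x
  · exact isUnit_of_mul_isUnit_right (hQPunit x)
  · refine (hPb x hx).trans ?_
    gcongr
    linarith

end Conjugation

/-- The conjugation lemma (fixed spectral parameter, left half-line): if the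
coefficient `A(x)` converges at exponential rate `e^{θ x}` to `Am` as
`x → -∞`, there is a conjugating matrix `P(x)`, invertible and exponentially
close to the identity, with `P' = A(x) P - P Am` on `(-∞, 0]`, so that
`W := P Z` solves `W' = A(x) W` whenever `Z' = Am Z`. -/
theorem stmt_8 (N : ℕ)
    (A : ℝ → (EuclideanSpace ℂ (Fin N) →L[ℂ] EuclideanSpace ℂ (Fin N)))
    (hcont : Continuous A)
    (Am : EuclideanSpace ℂ (Fin N) →L[ℂ] EuclideanSpace ℂ (Fin N))
    (C₁ θ : ℝ) (hC₁ : 0 < C₁) (hθ : 0 < θ)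
    (hconv : ∀ x : ℝ, x ≤ 0 → ‖A x - Am‖ ≤ C₁ * Real.exp (θ * x))
    (θb : ℝ) (hθb : 0 < θb) (hθbθ : θb < θ) :
    ∃ (C : ℝ) (P : ℝ → (EuclideanSpace ℂ (Fin N) →L[ℂ] EuclideanSpace ℂ (Fin N))),
      0 < C ∧
      (∀ x : ℝ, x ≤ 0 → HasDerivAt P (A x * P x - P x * Am) x) ∧
      (∀ x : ℝ, x ≤ 0 → IsUnit (P x)) ∧
      (∀ x : ℝ, x ≤ 0 → ‖P x - 1‖ ≤ C * Real.exp (θb * x)) :=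
  exists_conjugator hcont hθb hθbθ hconv
end

section
/- Let U ⊆ ℝⁿ be open and let F : U → ℝⁿ, η : U → ℝ, q : U → ℝ be twice continuously differentiable, and suppose that for every u ∈ U the compatibility relation Dη(u) ∘ DF(u) = Dq(u) holds (equality of linear maps ℝⁿ → ℝ, i.e., dη dF = dq). Then for every u ∈ U the bilinear form (v, w) ↦ D²η(u)(v, DF(u)w) is symmetric: D²η(u)(v, DF(u)w) = D²η(u)(w, DF(u)v) for all v, w ∈ ℝⁿ; equivalently, the matrix product (Hess η)(u) · DF(u) of the Hessian of η with the Jacobian of F is a symmetric matrix. -/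
open Filter Topology

/-- The expression of `D²q` obtained by differentiating a relation `A ∘ DF = Dq` that holds near
a point. -/
theorem fderiv_fderiv_of_eventually_comp_eq {E G H : Type*}
    [NormedAddCommGroup E] [NormedSpace ℝ E] [NormedAddCommGroup G] [NormedSpace ℝ G]
    [NormedAddCommGroup H] [NormedSpace ℝ H]
    {F : E → G} {A : E → G →L[ℝ] H} {q : E → H} {u : E}
    (hF : DifferentiableAt ℝ (fderiv ℝ F) u) (hA : DifferentiableAt ℝ A u)
    (h : ∀ᶠ x in 𝓝 u, (A x).comp (fderiv ℝ F x) = fderiv ℝ q x) (v w : E) :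
    fderiv ℝ (fderiv ℝ q) u v w =
      A u (fderiv ℝ (fderiv ℝ F) u v w) + fderiv ℝ A u v (fderiv ℝ F u w) := by
  have h' : fderiv ℝ q =ᶠ[𝓝 u] fun x => (A x).comp (fderiv ℝ F x) :=
    h.mono fun x hx => hx.symm
  rw [h'.fderiv_eq, fderiv_clm_comp hA hF]
  simp

/-- Forward direction of Godunov's proposition: if `(η, q)` is an
entropy/entropy-flux pair for the flux `F`, i.e. `dη ∘ dF = dq` on the open
set `U`, then the Hessian `d²η` symmetrizes the Jacobian `dF`:
`D²η(u)(v, DF(u)w) = D²η(u)(w, DF(u)v)`. -/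
theorem stmt_9 (n : ℕ) (U : Set (EuclideanSpace ℝ (Fin n))) (hU : IsOpen U)
    (F : EuclideanSpace ℝ (Fin n) → EuclideanSpace ℝ (Fin n))
    (η q : EuclideanSpace ℝ (Fin n) → ℝ)
    (hF : ContDiffOn ℝ 2 F U) (hη : ContDiffOn ℝ 2 η U) (hq : ContDiffOn ℝ 2 q U)
    (hcompat : ∀ u ∈ U, (fderiv ℝ η u).comp (fderiv ℝ F u) = fderiv ℝ q u) :
    ∀ u ∈ U, ∀ v w : EuclideanSpace ℝ (Fin n),
      fderiv ℝ (fderiv ℝ η) u v (fderiv ℝ F u w) =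
      fderiv ℝ (fderiv ℝ η) u w (fderiv ℝ F u v) := by
  intro u hu v w
  have hmem : U ∈ 𝓝 u := hU.mem_nhds hu
  have hF' := hF.contDiffAt hmem
  have hη' := hη.contDiffAt hmem
  have hq' := hq.contDiffAt hmem
  have dF : DifferentiableAt ℝ (fderiv ℝ F) u :=
    (hF'.fderiv_right (m := 1) (by norm_num)).differentiableAt (by norm_num)
  have dη : DifferentiableAt ℝ (fderiv ℝ η) u :=
    (hη'.fderiv_right (m := 1) (by norm_num)).differentiableAt (by norm_num)
  have key := fderiv_fderiv_of_eventually_comp_eq dF dη (eventually_of_mem hmem hcompat)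
  have symF := (hF'.isSymmSndFDerivAt (by simp)).eq v w
  have symq := (hq'.isSymmSndFDerivAt (by simp)).eq v w
  rw [key v w, key w v, symF] at symq
  exact add_left_cancel symq
end

section
/- Let θ > 0 and b ≥ 0. There exists C = C(θ, b) > 0 such that for every T ≥ 0 and every measurable function φ : [0, T] → [0, ∞], ∫₀ᵀ e^{−8θ(T−t)} (∫₀ᵗ (1 + t − s)^{−b} φ(s) ds)² dt ≤ C (∫₀ᵀ (1 + T − s)^{−b} φ(s) ds)². -/
open MeasureTheory

/-- Exponentials dominate powers: `(1 + u) ^ b ≤ K * exp (a * u)` for `u ≥ 0`. -/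
lemma exists_one_add_rpow_le_mul_exp {a b : ℝ} (ha : 0 < a) (hb : 0 ≤ b) :
    ∃ K > 0, ∀ u : ℝ, 0 ≤ u → (1 + u) ^ b ≤ K * Real.exp (a * u) := by
  set c := a / (b + 1) with hc_def
  have hc : 0 < c := by positivity
  refine ⟨(1 + 1 / c) ^ b, by positivity, fun u hu => ?_⟩
  have h1 : 1 + u ≤ (1 + 1 / c) * Real.exp (c * u) := by
    have h2 : (1 + 1 / c) * (c * u + 1) ≤ (1 + 1 / c) * Real.exp (c * u) := by
      gcongr
      exact Real.add_one_le_exp _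
    have h3 : (1 + 1 / c) * (c * u + 1) = c * u + 1 + u + 1 / c := by
      field_simp
      ring
    have h4 : 0 ≤ c * u := by positivity
    have h5 : 0 < 1 / c := by positivity
    linarith
  calc (1 + u) ^ b ≤ ((1 + 1 / c) * Real.exp (c * u)) ^ b := by gcongr
    _ = (1 + 1 / c) ^ b * Real.exp (c * u * b) := by
      rw [Real.mul_rpow (by positivity) (by positivity), ← Real.exp_mul]
    _ ≤ (1 + 1 / c) ^ b * Real.exp (a * u) := by
      have h6 : c * b ≤ a := by
        have : c * (b + 1) = a := by rw [hc_def]; field_simp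
        linarith
      rw [mul_right_comm]
      gcongr

/-- Exponential damping upgrades algebraic decay at time `t` to decay at a later time `T`. -/
lemma exists_exp_mul_rpow_neg_le {a b : ℝ} (ha : 0 < a) (hb : 0 ≤ b) :
    ∃ K > 0, ∀ s t T : ℝ, s ≤ t → t ≤ T →
      Real.exp (-a * (T - t)) * (1 + t - s) ^ (-b) ≤ K * (1 + T - s) ^ (-b) := by
  obtain ⟨K, hK, h⟩ := exists_one_add_rpow_le_mul_exp ha hb
  refine ⟨K, hK, fun s t T hst htT => ?_⟩
  have ht : 0 < 1 + t - s := by linarith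
  have hT : 0 < 1 + T - s := by linarith
  have hu : 0 ≤ T - t := by linarith
  have h1 : (1 + T - s) ^ b ≤ (1 + t - s) ^ b * (K * Real.exp (a * (T - t))) :=
    calc (1 + T - s) ^ b ≤ ((1 + t - s) * (1 + (T - t))) ^ b := by
          gcongr
          nlinarith [mul_nonneg (sub_nonneg.2 hst) hu]
      _ = (1 + t - s) ^ b * (1 + (T - t)) ^ b :=
          Real.mul_rpow ht.le (by linarith)
      _ ≤ _ := by
          gcongr
          exact h _ hu
  rw [Real.rpow_neg ht.le, Real.rpow_neg hT.le, neg_mul, Real.exp_neg, ← mul_inv,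
    ← div_eq_mul_inv, inv_le_comm₀ (by positivity) (by positivity), inv_div,
    div_le_iff₀ hK]
  linarith

/-- The exponential weight has mass at most `1 / a` on `[0, T]`. -/
lemma lintegral_Icc_exp_neg_mul_sub_le {a : ℝ} (ha : 0 < a) (T : ℝ) :
    ∫⁻ t in Set.Icc (0 : ℝ) T, ENNReal.ofReal (Real.exp (-a * (T - t))) ≤
      ENNReal.ofReal (1 / a) := by
  have h : ∀ t, Real.exp (-a * (T - t)) = Real.exp (-(a * T)) * Real.exp (a * t) := fun t => by
    rw [← Real.exp_add]
    ring_nf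
  simp_rw [h]
  refine (lintegral_mono_set Set.Icc_subset_Iic_self).trans ?_
  rw [← ofReal_integral_eq_lintegral_ofReal ((integrableOn_exp_mul_Iic ha T).const_mul _)
    (Filter.Eventually.of_forall fun t => by positivity), integral_const_mul,
    integral_exp_mul_Iic ha, ← mul_div_assoc, ← Real.exp_add]
  simp

/-- Scalar inequality underlying the weighted-in-time bound on the
low-frequency Duhamel term: for `θ > 0`, `b ≥ 0`, there is `C > 0` so that for
every `T ≥ 0` and measurable `φ : [0,T] → [0,∞]`,
`∫₀ᵀ e^{-8θ(T-t)} (∫₀ᵗ (1+t-s)^{-b} φ(s) ds)² dt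
  ≤ C (∫₀ᵀ (1+T-s)^{-b} φ(s) ds)²`. -/
theorem stmt_15 (θ b : ℝ) (hθ : 0 < θ) (hb : 0 ≤ b) :
    ∃ C > 0, ∀ T : ℝ, 0 ≤ T → ∀ φ : ℝ → ENNReal, Measurable φ →
      (∫⁻ t in Set.Icc (0 : ℝ) T, ENNReal.ofReal (Real.exp (-8 * θ * (T - t))) *
          (∫⁻ s in Set.Icc (0 : ℝ) t, ENNReal.ofReal ((1 + t - s) ^ (-b)) * φ s) ^ 2)
        ≤ ENNReal.ofReal C *
          (∫⁻ s in Set.Icc (0 : ℝ) T, ENNReal.ofReal ((1 + T - s) ^ (-b)) * φ s) ^ 2 := by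
  obtain ⟨K, hK, hker⟩ := exists_exp_mul_rpow_neg_le (a := 2 * θ) (by positivity) hb
  refine ⟨1 / (4 * θ) * K ^ 2, by positivity, fun T _ φ _ => ?_⟩
  set J := ∫⁻ s in Set.Icc (0 : ℝ) T, ENNReal.ofReal ((1 + T - s) ^ (-b)) * φ s with hJ
  have hinner : ∀ t ∈ Set.Icc (0 : ℝ) T,
      ENNReal.ofReal (Real.exp (-(2 * θ) * (T - t))) *
        (∫⁻ s in Set.Icc (0 : ℝ) t, ENNReal.ofReal ((1 + t - s) ^ (-b)) * φ s) ≤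
      ENNReal.ofReal K * J := fun t ht => by
    rw [← lintegral_const_mul' _ _ ENNReal.ofReal_ne_top, hJ,
      ← lintegral_const_mul' _ _ ENNReal.ofReal_ne_top]
    refine (setLIntegral_mono' measurableSet_Icc fun s hs => ?_).trans
      (lintegral_mono_set (Set.Icc_subset_Icc_right ht.2))
    rw [← mul_assoc, ← mul_assoc, ← ENNReal.ofReal_mul (Real.exp_pos _).le,
      ← ENNReal.ofReal_mul hK.le]
    gcongr ?_ * _
    exact ENNReal.ofReal_le_ofReal (hker s t T hs.2 ht.2)
  have hexp : ∀ t, ENNReal.ofReal (Real.exp (-8 * θ * (T - t))) =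
      ENNReal.ofReal (Real.exp (-(4 * θ) * (T - t))) *
        ENNReal.ofReal (Real.exp (-(2 * θ) * (T - t))) ^ 2 := fun t => by
    rw [← ENNReal.ofReal_pow (Real.exp_pos _).le, ← ENNReal.ofReal_mul (Real.exp_pos _).le,
      ← Real.exp_nat_mul, ← Real.exp_add]
    congr 2
    push_cast
    ring
  calc _ ≤ ∫⁻ t in Set.Icc (0 : ℝ) T, ENNReal.ofReal (Real.exp (-(4 * θ) * (T - t))) *
        (ENNReal.ofReal K * J) ^ 2 := by
        refine setLIntegral_mono' measurableSet_Icc fun t ht => ?_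
        rw [hexp, mul_assoc, ← mul_pow]
        gcongr _ * ?_ ^ 2
        exact hinner t ht
    _ = (∫⁻ t in Set.Icc (0 : ℝ) T, ENNReal.ofReal (Real.exp (-(4 * θ) * (T - t)))) *
        (ENNReal.ofReal K * J) ^ 2 := lintegral_mul_const _ (by fun_prop)
    _ ≤ ENNReal.ofReal (1 / (4 * θ)) * (ENNReal.ofReal K * J) ^ 2 := by
        gcongr
        exact lintegral_Icc_exp_neg_mul_sub_le (by positivity) T
    _ = _ := by
        rw [ENNReal.ofReal_mul (by positivity), ENNReal.ofReal_pow hK.le, mul_pow, mul_assoc]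
end

section
/- Let A be an n×n complex matrix and let ad_A : M_n(ℂ) → M_n(ℂ) denote the linear map ad_A(P) = AP − PA. Then ker(ad_A ∘ ad_A) = ker(ad_A) if and only if for every μ ∈ ℂ one has ker((A − μI)²) = ker(A − μI); that is, the eigenvalue 0 of the Sylvester operator ad_A is semisimple if and only if every eigenvalue of A is semisimple. -/
open Matrix

theorem Module.End.apply_eq_zero_of_pow_apply_eq_zero {K V : Type*} [Semiring K]
    [AddCommMonoid V] [Module K V] {f : Module.End K V}
    (hf : ∀ v, f (f v) = 0 → f v = 0) (k : ℕ) {v : V} (hv : (f ^ k) v = 0) : f v = 0 := by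
  induction k generalizing v with
  | zero =>
    have hv : v = 0 := by simpa using hv
    simp [hv]
  | succ k ih => exact hf v (ih (by simpa [pow_succ] using hv))

/-- If every eigenvalue of `f` is semisimple, then a commutator `f * g - g * f` which commutes
with `f` vanishes. -/
theorem Module.End.commutator_eq_zero_of_commute {K V : Type*} [Field K] [IsAlgClosed K]
    [AddCommGroup V] [Module K V] [FiniteDimensional K V] {f g : Module.End K V}
    (hf : ∀ (μ : K) (v : V), (f - μ • 1) ((f - μ • 1) v) = 0 → (f - μ • 1) v = 0)
    (hg : Commute f (f * g - g * f)) : f * g - g * f = 0 := by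
  rw [← LinearMap.ker_eq_top, eq_top_iff, ← Module.End.iSup_maxGenEigenspace_eq_top f]
  refine iSup_le fun μ v hv => ?_
  obtain ⟨k, hk⟩ := (Module.End.mem_maxGenEigenspace f μ v).1 hv
  have hv0 : (f - μ • 1) v = 0 := apply_eq_zero_of_pow_apply_eq_zero (hf μ) k hk
  have hfv : f v = μ • v := by simpa [sub_eq_zero] using hv0
  have hgv : (f - μ • 1) (g v) = (f * g - g * f) v := by simp [hfv]
  have hcomm : f ((f * g - g * f) v) = (f * g - g * f) (f v) := LinearMap.congr_fun hg.eq v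
  rw [LinearMap.mem_ker, ← hgv]
  refine hf μ _ ?_
  rw [hgv, LinearMap.sub_apply, hcomm, hfv, map_smul]
  simp

/-- If `ker (ad B)² ≤ ker (ad B)`, then `ker B² ≤ ker B`. -/
theorem Matrix.mulVec_eq_zero_of_sq_mulVec_eq_zero {K ι : Type*} [Field K] [Fintype ι]
    [DecidableEq ι] {B : Matrix ι ι K}
    (hB : ∀ P : Matrix ι ι K,
      B * (B * P - P * B) - (B * P - P * B) * B = 0 → B * P - P * B = 0)
    {v : ι → K} (hv : (B ^ 2) *ᵥ v = 0) : B *ᵥ v = 0 := by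
  by_contra hne
  have hv' : B *ᵥ (B *ᵥ v) = 0 := by rwa [mulVec_mulVec, ← sq]
  obtain ⟨φ, hφ, hφB⟩ := exists_vecMul_eq_zero_iff.2
    (exists_mulVec_eq_zero_iff.1 ⟨B *ᵥ v, hne, hv'⟩)
  have hP : B * vecMulVec v φ - vecMulVec v φ * B = vecMulVec (B *ᵥ v) φ := by
    rw [mul_vecMulVec, vecMulVec_mul, hφB, vecMulVec_zero, sub_zero]
  have h := hB (vecMulVec v φ) (by
    rw [hP, mul_vecMulVec, vecMulVec_mul, hφB, hv', vecMulVec_zero, zero_vecMulVec, sub_zero])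
  rw [hP, vecMulVec_eq_zero] at h
  exact h.elim hne hφ

/-- Exercise (jordanex, part (ii)): the eigenvalue `0` of the Sylvester
operator `ad_A : P ↦ AP - PA` is semisimple (i.e. `ker (ad_A²) = ker ad_A`)
iff every eigenvalue of `A` is semisimple (i.e. `ker (A - μ)² = ker (A - μ)`
for every `μ ∈ ℂ`). -/
theorem stmt_18 (n : ℕ) (A : Matrix (Fin n) (Fin n) ℂ) :
    ({P : Matrix (Fin n) (Fin n) ℂ |
        A * (A * P - P * A) - (A * P - P * A) * A = 0} =
      {P : Matrix (Fin n) (Fin n) ℂ | A * P - P * A = 0}) ↔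
    (∀ μ : ℂ, {v : Fin n → ℂ |
        ((A - μ • (1 : Matrix (Fin n) (Fin n) ℂ)) ^ 2).mulVec v = 0} =
      {v : Fin n → ℂ | (A - μ • (1 : Matrix (Fin n) (Fin n) ℂ)).mulVec v = 0}) := by
  constructor
  · intro h μ
    ext v
    simp only [Set.mem_ofPred_eq]
    refine ⟨fun hv => mulVec_eq_zero_of_sq_mulVec_eq_zero (fun P hP => ?_) hv, fun hv => ?_⟩
    · have hcomm (Q : Matrix (Fin n) (Fin n) ℂ) :
          (A - μ • 1) * Q - Q * (A - μ • 1) = A * Q - Q * A := by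
        simp [sub_mul, mul_sub]
      rw [hcomm, hcomm] at hP
      rw [hcomm]
      exact h.subset hP
    · rw [sq, ← mulVec_mulVec, hv, mulVec_zero]
  · intro h
    ext P
    simp only [Set.mem_ofPred_eq]
    refine ⟨fun hP => ?_, fun hP => by simp [hP]⟩
    have hcomm := congrArg toLinAlgEquiv' (sub_eq_zero.1 hP)
    apply (toLinAlgEquiv' (R := ℂ) (n := Fin n)).injective
    simp only [map_mul, map_sub, map_zero] at hcomm ⊢
    refine Module.End.commutator_eq_zero_of_commute (fun μ v hv => ?_) hcomm
    have hA : toLinAlgEquiv' A - μ • 1 = toLinAlgEquiv' (A - μ • 1) := by simp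
    rw [hA] at hv ⊢
    simp only [toLinAlgEquiv'_apply, mulVec_mulVec, ← sq] at hv ⊢
    exact (h μ).subset hv
end
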